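/- Uniqueness for the periodic scattering problem. Let u₀(x,y) = e^{ik(x cos θ − y sin θ)} be the incident plane wave. Suppose u₁ and u₂ are both continuous on the closure of D, continuously differentiable up to the boundary, twice continuously differentiable in D, satisfy Δu_i + k²u_i = 0 in D, u_i = 0 on S, the quasiperiodicity conditions, and u_i − u₀ is outgoing (i = 1, 2). Then u₁ = u₂ everywhere in D. -/

import Mathlib

open MeasureTheory

namespace PeriodicScattering

open Set Filter Topology

/-- The strict epigraph of `f`, as a subset of the plane. -/
def epi (f : ℝ → ℝ) : Set (ℝ × ℝ) := {p | f p.1 < p.2}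

/-- The closed epigraph of `f`. -/
def epiClosed (f : ℝ → ℝ) : Set (ℝ × ℝ) := {p | f p.1 ≤ p.2}

theorem isOpen_epi {f : ℝ → ℝ} (hf : Continuous f) : IsOpen (epi f) :=
  isOpen_lt (hf.comp continuous_fst) continuous_snd

theorem isClosed_epiClosed {f : ℝ → ℝ} (hf : Continuous f) : IsClosed (epiClosed f) :=
  isClosed_le (hf.comp continuous_fst) continuous_snd

theorem epi_subset_epiClosed (f : ℝ → ℝ) : epi f ⊆ epiClosed f :=
  fun p (hp : f p.1 < p.2) => hp.le

variable {E : Type*} [NormedAddCommGroup E]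

theorem continuousOn_vertical {f : ℝ → ℝ} {g : ℝ × ℝ → E} (hg : ContinuousOn g (epi f)) (x : ℝ) :
    ContinuousOn (fun r => g (x, r)) (Ioi (f x)) :=
  hg.comp (by fun_prop) fun _ hr => hr

theorem uIcc_subset_Ioi_of_lt {a b c : ℝ} (ha : c < a) (hb : c < b) : uIcc a b ⊆ Ioi c :=
  fun _ hr => (lt_min ha hb).trans_le hr.1

theorem intervalIntegrable_vertical {f : ℝ → ℝ} {g : ℝ × ℝ → E}
    (hg : ContinuousOn g (epi f)) {x a b : ℝ}
    (ha : f x < a) (hb : f x < b) :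
    IntervalIntegrable (fun r => g (x, r)) volume a b :=
  ((continuousOn_vertical hg x).mono (uIcc_subset_Ioi_of_lt ha hb)).intervalIntegrable

variable [NormedSpace ℝ E]

/-- The primitive of `g` in the second variable that vanishes at height `H`. -/
noncomputable def prim (H : ℝ) (g : ℝ × ℝ → E) (p : ℝ × ℝ) : E :=
  ∫ r in H..p.2, g (p.1, r)

section Vertical

variable {f : ℝ → ℝ} {H : ℝ} {g : ℝ × ℝ → E}

theorem continuousOn_prim (hf : Continuous f) (hH : ∀ x, f x < H)
    (hg : ContinuousOn g (epi f)) : ContinuousOn (prim H g) (epi f) := by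
  rintro ⟨x₀, z₀⟩ hp
  refine ContinuousAt.continuousWithinAt ?_
  set δ := (min z₀ H - f x₀) / 2 with hδ
  have hm : f x₀ < min z₀ H := lt_min hp (hH x₀)
  have hδ0 : 0 < δ := by simp only [hδ]; linarith
  have hδm : f x₀ + δ < min z₀ H := by simp only [hδ]; linarith
  have hclamp : Continuous fun q : ℝ × ℝ => g (q.1, max q.2 (f q.1 + δ)) := by
    refine hg.comp_continuous (by fun_prop) fun q => ?_
    exact (lt_add_of_pos_right _ hδ0).trans_le (le_max_right q.2 _)
  have hcont : Continuous fun p : ℝ × ℝ => ∫ r in H..p.2, g (p.1, max r (f p.1 + δ)) :=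
    intervalIntegral.continuous_parametric_primitive_of_continuous
      (f := fun x r => g (x, max r (f x + δ))) hclamp
  refine hcont.continuousAt.congr ?_
  have hev : ∀ᶠ p : ℝ × ℝ in 𝓝 (x₀, z₀), f p.1 + δ < min p.2 H :=
    ContinuousAt.eventually_lt (f := fun p : ℝ × ℝ => f p.1 + δ) (g := fun p => min p.2 H)
      (by fun_prop) (by fun_prop) hδm
  filter_upwards [hev] with p hpp
  refine intervalIntegral.integral_congr fun r hr => ?_
  have : f p.1 + δ ≤ r := by
    have h1 := hr.1
    rw [min_comm] at h1
    exact hpp.le.trans h1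
  simp only [max_eq_left this]

theorem hasDerivAt_prim_snd [CompleteSpace E] (hH : ∀ x, f x < H)
    (hg : ContinuousOn g (epi f)) {p : ℝ × ℝ} (hp : p ∈ epi f) :
    HasDerivAt (fun z => prim H g (p.1, z)) (g p) p.2 := by
  have hI : Ioi (f p.1) ∈ 𝓝 p.2 := Ioi_mem_nhds hp
  exact intervalIntegral.integral_hasDerivAt_right (intervalIntegrable_vertical hg (hH _) hp)
    ((continuousOn_vertical hg p.1).stronglyMeasurableAtFilter isOpen_Ioi _ hp)
    ((continuousOn_vertical hg p.1).continuousAt hI)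

theorem hasDerivAt_prim_fst {gx : ℝ × ℝ → E} (hf : Continuous f) (hH : ∀ x, f x < H)
    (hg : ContinuousOn g (epi f)) (hgx : ContinuousOn gx (epi f))
    (hd : ∀ p ∈ epi f, HasDerivAt (fun t => g (t, p.2)) (gx p) p.1)
    {p : ℝ × ℝ} (hp : p ∈ epi f) :
    HasDerivAt (fun t => prim H g (t, p.2)) (prim H gx p) p.1 := by
  have hm : f p.1 < min p.2 H := lt_min hp (hH _)
  obtain ⟨s, hs, hsub⟩ : ∃ s ∈ 𝓝 p.1, IsCompact s ∧ ∀ t ∈ s, f t < min p.2 H := by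
    have : {t | f t < min p.2 H} ∈ 𝓝 p.1 := (isOpen_lt hf continuous_const).mem_nhds hm
    obtain ⟨s, hs, h1, h2⟩ := local_compact_nhds this
    exact ⟨s, hs, h2, h1⟩
  have hsegm : ∀ t ∈ s, ∀ r ∈ uIcc H p.2, ((t, r) : ℝ × ℝ) ∈ epi f := fun t ht r hr =>
    (hsub.2 t ht).trans_le (by rw [min_comm]; exact hr.1)
  obtain ⟨C, hC⟩ := (hsub.1.prod (isCompact_uIcc (a := H) (b := p.2))).exists_bound_of_continuousOn
    (hgx.mono fun q hq => hsegm q.1 hq.1 q.2 hq.2)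
  have hint : ∀ t ∈ s, IntervalIntegrable (fun r => g (t, r)) volume H p.2 := fun t ht =>
    intervalIntegrable_vertical hg (hH _) ((hsub.2 t ht).trans_le (min_le_left _ _))
  refine (intervalIntegral.hasDerivAt_integral_of_dominated_loc_of_deriv_le
    (F := fun t r => g (t, r)) (F' := fun t r => gx (t, r)) (bound := fun _ => C) hs ?_ ?_ ?_ ?_
    (by simp) ?_).2
  · filter_upwards [hs] with t ht using (hint t ht).def'.aestronglyMeasurable
  · exact hint _ (mem_of_mem_nhds hs)
  · exact (intervalIntegrable_vertical hgx (hH _) hp).def'.aestronglyMeasurable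
  · exact .of_forall fun r hr t ht => hC (t, r) ⟨ht, uIoc_subset_uIcc hr⟩
  · exact .of_forall fun r hr t ht => hd (t, r) (hsegm t ht r (uIoc_subset_uIcc hr))

theorem continuous_integral_above_graph {a : ℝ → ℝ} (hf : Continuous f) (hH : ∀ x, f x < H)
    (ha : Continuous a) (hfa : ∀ x, f x < a x) (hg : ContinuousOn g (epi f)) :
    Continuous fun x => ∫ y in (a x)..H, g (x, y) := by
  have h := (continuousOn_prim hf hH hg).comp_continuous (continuous_id.prodMk ha) hfa
  convert h.neg using 2 with x
  exact intervalIntegral.integral_symm _ _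

end Vertical

/-- A function with continuous partial derivatives on an open set is strictly differentiable. -/
theorem hasStrictFDerivAt_of_partials {U : Set (ℝ × ℝ)} (hU : IsOpen U) {w wx wy : ℝ × ℝ → E}
    (hwx : ContinuousOn wx U) (hwy : ContinuousOn wy U)
    (h1 : ∀ p ∈ U, HasDerivAt (fun t => w (t, p.2)) (wx p) p.1)
    (h2 : ∀ p ∈ U, HasDerivAt (fun t => w (p.1, t)) (wy p) p.2) {p : ℝ × ℝ} (hp : p ∈ U) :
    HasStrictFDerivAt w ((ContinuousLinearMap.toSpanSingleton ℝ (wx p)).coprod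
      (ContinuousLinearMap.toSpanSingleton ℝ (wy p))) p := by
  have hev : ∀ᶠ v in 𝓝 p, v ∈ U := hU.mem_nhds hp
  have hc : Continuous fun e : E => ContinuousLinearMap.toSpanSingleton ℝ e :=
    (ContinuousLinearMap.toSpanSingletonCLE (𝕜 := ℝ) (E := E)).continuous
  exact hasStrictFDerivAt_uncurry_coprod (u := p) (f := fun a b => w (a, b))
    (f₁ := fun a b => ContinuousLinearMap.toSpanSingleton ℝ (wx (a, b)))
    (f₂ := fun a b => ContinuousLinearMap.toSpanSingleton ℝ (wy (a, b)))
    (by filter_upwards [hev] with v hv using (h1 v hv).hasFDerivAt)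
    (by filter_upwards [hev] with v hv using (h2 v hv).hasFDerivAt)
    (hc.continuousAt.comp (hwx.continuousAt (hU.mem_nhds hp)))
    (hc.continuousAt.comp (hwy.continuousAt (hU.mem_nhds hp)))

/-- The chain rule along a graph. -/
theorem hasDerivAt_comp_graph {w : ℝ × ℝ → E} {a b : E} {g : ℝ → ℝ} {x d : ℝ}
    (hw : HasStrictFDerivAt w ((ContinuousLinearMap.toSpanSingleton ℝ a).coprod
      (ContinuousLinearMap.toSpanSingleton ℝ b)) (x, g x)) (hg : HasDerivAt g d x) :
    HasDerivAt (fun t => w (t, g t)) (a + d • b) x := by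
  have := hw.hasFDerivAt.comp_hasDerivAt x ((hasDerivAt_id x).prodMk hg)
  simpa using! this

/-- The divergence theorem for a horizontally periodic field between a Lipschitz graph and a
horizontal line. -/
theorem integral_flux_eq {f g : ℝ → ℝ} {H L : ℝ} {K : NNReal} (hf : Continuous f)
    (hH : ∀ x, f x < H) (hg : LipschitzWith K g) (hfg : ∀ x, f x < g x)
    (hgper : ∀ x, g (x + L) = g x)
    {P Px Q Qy : ℝ × ℝ → ℝ} (hP : ContinuousOn P (epi f)) (hPx : ContinuousOn Px (epi f))
    (hQy : ContinuousOn Qy (epi f))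
    (hdP : ∀ p ∈ epi f, HasDerivAt (fun t => P (t, p.2)) (Px p) p.1)
    (hdQ : ∀ p ∈ epi f, HasDerivAt (fun t => Q (p.1, t)) (Qy p) p.2)
    (hPper : ∀ p ∈ epi f, P (p.1 + L, p.2) = P p) :
    ∫ x in (0 : ℝ)..L, (Q (x, H) - (Q (x, g x) - deriv g x * P (x, g x))) =
      ∫ x in (0 : ℝ)..L, ∫ y in (g x)..H, (Px (x, y) + Qy (x, y)) := by
  set G : ℝ → ℝ := fun x => prim H P (x, g x) with hG
  have hmem : ∀ x, ((x, g x) : ℝ × ℝ) ∈ epi f := hfg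
  have hstrict : ∀ x, HasStrictFDerivAt (prim H P)
      ((ContinuousLinearMap.toSpanSingleton ℝ (prim H Px (x, g x))).coprod
        (ContinuousLinearMap.toSpanSingleton ℝ (P (x, g x)))) (x, g x) := fun x =>
    hasStrictFDerivAt_of_partials (isOpen_epi hf) (continuousOn_prim hf hH hPx) hP
      (fun p hp => hasDerivAt_prim_fst hf hH hP hPx hdP hp)
      (fun p hp => hasDerivAt_prim_snd hH hP hp) (hmem x)
  have hGlip : LocallyLipschitz G := by
    intro x
    obtain ⟨C, s, hs, hC⟩ := (hstrict x).exists_lipschitzOnWith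
    have hgr : LipschitzWith (max 1 K) fun x => (x, g x) := LipschitzWith.id.prodMk hg
    refine ⟨C * max 1 K, (fun x => (x, g x)) ⁻¹' s, hgr.continuous.continuousAt hs, ?_⟩
    exact hC.comp hgr.lipschitzOnWith (fun _ h => h)
  obtain ⟨C, hC⟩ := (hGlip.locallyLipschitzOn (s := uIcc 0 L)).exists_lipschitzOnWith_of_compact
    isCompact_uIcc
  have hAC := hC.absolutelyContinuousOnInterval
  have hGper : G L = G 0 := by
    simp only [hG, prim]
    have h0 : g L = g 0 := by simpa using hgper 0
    rw [h0]
    refine intervalIntegral.integral_congr fun r hr => ?_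
    have : ((0, r) : ℝ × ℝ) ∈ epi f := uIcc_subset_Ioi_of_lt (hH 0) (hfg 0) hr
    simpa using hPper _ this
  have hzero : ∫ x in (0 : ℝ)..L, deriv G x = 0 := by
    rw [hAC.integral_deriv_eq_sub, hGper, sub_self]
  have hcont : Continuous fun x => ∫ y in (g x)..H, (Px (x, y) + Qy (x, y)) :=
    continuous_integral_above_graph hf hH hg.continuous hfg (hPx.add hQy)
  have hsum : ∫ x in (0 : ℝ)..L, (Q (x, H) - (Q (x, g x) - deriv g x * P (x, g x))) =
      ∫ x in (0 : ℝ)..L, ((∫ y in (g x)..H, (Px (x, y) + Qy (x, y))) + deriv G x) := by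
    refine intervalIntegral.integral_congr_ae ?_
    filter_upwards [hg.ae_differentiableAt_real] with x hx _
    have hGd : deriv G x = prim H Px (x, g x) + deriv g x * P (x, g x) :=
      (hasDerivAt_comp_graph (hstrict x) hx.hasDerivAt).deriv
    have hFTC : ∫ y in (g x)..H, Qy (x, y) = Q (x, H) - Q (x, g x) :=
      intervalIntegral.integral_eq_sub_of_hasDerivAt (f := fun y => Q (x, y))
        (fun y hy => hdQ (x, y) (uIcc_subset_Ioi_of_lt (hfg x) (hH x) hy))
        (intervalIntegrable_vertical hQy (hfg x) (hH x))
    rw [intervalIntegral.integral_add (intervalIntegrable_vertical hPx (hfg x) (hH x))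
      (intervalIntegrable_vertical hQy (hfg x) (hH x)), hFTC, hGd, prim,
      intervalIntegral.integral_symm H]
    ring
  rw [hsum, intervalIntegral.integral_add (hcont.intervalIntegrable _ _)
    hAC.intervalIntegrable_deriv, hzero, add_zero]

/-- First-order data of a quasiperiodic solution of the Helmholtz equation above the graph of `f`,
continuous up to the graph. -/
structure IsSolution (f : ℝ → ℝ) (k L : ℝ) (ν : ℂ) (u ux uy uxx uyy : ℝ × ℝ → ℂ) : Prop where
  cont : ContinuousOn u (epiClosed f)
  cont_x : ContinuousOn ux (epiClosed f)
  cont_y : ContinuousOn uy (epiClosed f)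
  cont_xx : ContinuousOn uxx (epi f)
  cont_yy : ContinuousOn uyy (epi f)
  deriv_x : ∀ p ∈ epiClosed f, HasDerivAt (fun t => u (t, p.2)) (ux p) p.1
  deriv_y : ∀ p ∈ epiClosed f, HasDerivAt (fun t => u (p.1, t)) (uy p) p.2
  deriv_xx : ∀ p ∈ epi f, HasDerivAt (fun t => ux (t, p.2)) (uxx p) p.1
  deriv_yy : ∀ p ∈ epi f, HasDerivAt (fun t => uy (p.1, t)) (uyy p) p.2
  helmholtz : ∀ p ∈ epi f, uxx p + uyy p + (k : ℂ) ^ 2 * u p = 0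
  quasi : ∀ p ∈ epiClosed f, u (p.1 + L, p.2) = ν * u p
  quasi_x : ∀ p ∈ epiClosed f, ux (p.1 + L, p.2) = ν * ux p

/-- A quasiperiodic solution of the Helmholtz equation in the epigraph of `f` which has all
continuous second-order partial derivatives, including the mixed one. -/
structure IsRegularSolution (f : ℝ → ℝ) (k L : ℝ) (ν : ℂ) (v vx vy vxx vxy vyy : ℝ × ℝ → ℂ) :
    Prop where
  cont : ContinuousOn v (epi f)
  cont_x : ContinuousOn vx (epi f)
  cont_y : ContinuousOn vy (epi f)
  cont_xx : ContinuousOn vxx (epi f)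
  cont_xy : ContinuousOn vxy (epi f)
  cont_yy : ContinuousOn vyy (epi f)
  deriv_x : ∀ p ∈ epi f, HasDerivAt (fun t => v (t, p.2)) (vx p) p.1
  deriv_y : ∀ p ∈ epi f, HasDerivAt (fun t => v (p.1, t)) (vy p) p.2
  deriv_xx : ∀ p ∈ epi f, HasDerivAt (fun t => vx (t, p.2)) (vxx p) p.1
  deriv_xy : ∀ p ∈ epi f, HasDerivAt (fun t => vx (p.1, t)) (vxy p) p.2
  deriv_yx : ∀ p ∈ epi f, HasDerivAt (fun t => vy (t, p.2)) (vxy p) p.1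
  deriv_yy : ∀ p ∈ epi f, HasDerivAt (fun t => vy (p.1, t)) (vyy p) p.2
  helmholtz : ∀ p ∈ epi f, vxx p + vyy p + (k : ℂ) ^ 2 * v p = 0
  quasi : ∀ p ∈ epi f, v (p.1 + L, p.2) = ν * v p
  quasi_x : ∀ p ∈ epi f, vx (p.1 + L, p.2) = ν * vx p
  quasi_y : ∀ p ∈ epi f, vy (p.1 + L, p.2) = ν * vy p

/-- The normal component, relative to the downward slope `d`, of the Rellich field with multiplier
`2 y ∂_y v + v`. -/
def rellichFlux (k d y : ℝ) (v vx vy : ℂ) : ℝ :=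
  y * ((vy.re ^ 2 + vy.im ^ 2) - (vx.re ^ 2 + vx.im ^ 2) + k ^ 2 * (v.re ^ 2 + v.im ^ 2)) +
      (v.re * vy.re + v.im * vy.im) -
    d * (2 * y * (vy.re * vx.re + vy.im * vx.im) + (v.re * vx.re + v.im * vx.im))

/-- The normal component, relative to the downward slope `d`, of the energy flux `Im (v̄ ∇v)`. -/
def energyFlux (d : ℝ) (v vx vy : ℂ) : ℝ :=
  (v.re * vy.im - v.im * vy.re) - d * (v.re * vx.im - v.im * vx.re)

theorem _root_.HasDerivAt.complex_re {w : ℝ → ℂ} {w' : ℂ} {x : ℝ} (h : HasDerivAt w w' x) :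
    HasDerivAt (fun t => (w t).re) w'.re x :=
  Complex.reCLM.hasFDerivAt.comp_hasDerivAt x h

theorem _root_.HasDerivAt.complex_im {w : ℝ → ℂ} {w' : ℂ} {x : ℝ} (h : HasDerivAt w w' x) :
    HasDerivAt (fun t => (w t).im) w'.im x :=
  Complex.imCLM.hasFDerivAt.comp_hasDerivAt x h

theorem re_sq_add_im_sq {ν : ℂ} (hν : ‖ν‖ = 1) : ν.re ^ 2 + ν.im ^ 2 = 1 := by
  have h := Complex.sq_norm ν
  rw [hν, Complex.normSq_apply] at h
  linarith

section Identities

variable {f g : ℝ → ℝ} {k H L : ℝ} {K : NNReal} {ν : ℂ} {v vx vy vxx vxy vyy : ℝ × ℝ → ℂ}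

theorem IsRegularSolution.helmholtz_re (hv : IsRegularSolution f k L ν v vx vy vxx vxy vyy)
    {p : ℝ × ℝ} (hp : p ∈ epi f) : (vxx p).re + (vyy p).re + k ^ 2 * (v p).re = 0 := by
  have h := congrArg Complex.re (hv.helmholtz p hp)
  rw [← Complex.ofReal_pow, Complex.add_re, Complex.add_re, Complex.re_ofReal_mul] at h
  exact h

theorem IsRegularSolution.helmholtz_im (hv : IsRegularSolution f k L ν v vx vy vxx vxy vyy)
    {p : ℝ × ℝ} (hp : p ∈ epi f) : (vxx p).im + (vyy p).im + k ^ 2 * (v p).im = 0 := by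
  have h := congrArg Complex.im (hv.helmholtz p hp)
  rw [← Complex.ofReal_pow, Complex.add_im, Complex.add_im, Complex.im_ofReal_mul] at h
  exact h

theorem IsRegularSolution.energy_identity (hv : IsRegularSolution f k L ν v vx vy vxx vxy vyy)
    (hν : ‖ν‖ = 1) (hf : Continuous f) (hH : ∀ x, f x < H) (hg : LipschitzWith K g)
    (hfg : ∀ x, f x < g x) (hgper : ∀ x, g (x + L) = g x) :
    ∫ x in (0 : ℝ)..L, (energyFlux 0 (v (x, H)) (vx (x, H)) (vy (x, H)) -
      energyFlux (deriv g x) (v (x, g x)) (vx (x, g x)) (vy (x, g x))) = 0 := by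
  obtain ⟨c0, c1, c2, c11, c12, c22, d1, d2, d11, d12, d21, d22, -, q0, q1, q2⟩ := id hv
  have key := integral_flux_eq (P := fun p => (v p).re * (vx p).im - (v p).im * (vx p).re)
    (Px := fun p => (v p).re * (vxx p).im - (v p).im * (vxx p).re)
    (Q := fun p => (v p).re * (vy p).im - (v p).im * (vy p).re)
    (Qy := fun p => (v p).re * (vyy p).im - (v p).im * (vyy p).re) (L := L)
    hf hH hg hfg hgper (by fun_prop) (by fun_prop) (by fun_prop) ?_ ?_ ?_
  · simp only [energyFlux, zero_mul, sub_zero]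
    rw [key]
    refine intervalIntegral.integral_zero_ae (.of_forall fun x _ => ?_)
    refine intervalIntegral.integral_zero_ae (.of_forall fun y hy => ?_)
    have hp : ((x, y) : ℝ × ℝ) ∈ epi f :=
      uIcc_subset_Ioi_of_lt (hfg x) (hH x) (uIoc_subset_uIcc hy)
    linear_combination (v (x, y)).re * hv.helmholtz_im hp - (v (x, y)).im * hv.helmholtz_re hp
  · intro p hp
    convert! ((d1 p hp).complex_re.mul (d11 p hp).complex_im).sub
      ((d1 p hp).complex_im.mul (d11 p hp).complex_re) using 1
    ring
  · intro p hp
    convert! ((d2 p hp).complex_re.mul (d22 p hp).complex_im).sub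
      ((d2 p hp).complex_im.mul (d22 p hp).complex_re) using 1
    ring
  · intro p hp
    simp only [q0 p hp, q1 p hp, Complex.mul_re, Complex.mul_im]
    linear_combination ((v p).re * (vx p).im - (v p).im * (vx p).re) * re_sq_add_im_sq hν

theorem IsRegularSolution.rellich_identity (hv : IsRegularSolution f k L ν v vx vy vxx vxy vyy)
    (hν : ‖ν‖ = 1) (hf : Continuous f) (hH : ∀ x, f x < H) (hg : LipschitzWith K g)
    (hfg : ∀ x, f x < g x) (hgper : ∀ x, g (x + L) = g x) :
    ∫ x in (0 : ℝ)..L, (rellichFlux k 0 H (v (x, H)) (vx (x, H)) (vy (x, H)) -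
      rellichFlux k (deriv g x) (g x) (v (x, g x)) (vx (x, g x)) (vy (x, g x))) =
    ∫ x in (0 : ℝ)..L, ∫ y in (g x)..H, 2 * ‖vy (x, y)‖ ^ 2 := by
  obtain ⟨c0, c1, c2, c11, c12, c22, d1, d2, d11, d12, d21, d22, -, q0, q1, q2⟩ := id hv
  have key := integral_flux_eq
    (P := fun p => 2 * p.2 * ((vy p).re * (vx p).re + (vy p).im * (vx p).im) +
      ((v p).re * (vx p).re + (v p).im * (vx p).im))
    (Px := fun p => 2 * p.2 * (((vxy p).re * (vx p).re + (vy p).re * (vxx p).re) +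
        ((vxy p).im * (vx p).im + (vy p).im * (vxx p).im)) +
      (((vx p).re * (vx p).re + (v p).re * (vxx p).re) +
        ((vx p).im * (vx p).im + (v p).im * (vxx p).im)))
    (Q := fun p => p.2 * (((vy p).re ^ 2 + (vy p).im ^ 2) - ((vx p).re ^ 2 + (vx p).im ^ 2) +
        k ^ 2 * ((v p).re ^ 2 + (v p).im ^ 2)) + ((v p).re * (vy p).re + (v p).im * (vy p).im))
    (Qy := fun p => (((vy p).re ^ 2 + (vy p).im ^ 2) - ((vx p).re ^ 2 + (vx p).im ^ 2) +
        k ^ 2 * ((v p).re ^ 2 + (v p).im ^ 2)) +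
      p.2 * (2 * ((vy p).re * (vyy p).re + (vy p).im * (vyy p).im) -
        2 * ((vx p).re * (vxy p).re + (vx p).im * (vxy p).im) +
        2 * k ^ 2 * ((v p).re * (vy p).re + (v p).im * (vy p).im)) +
      (((vy p).re * (vy p).re + (v p).re * (vyy p).re) +
        ((vy p).im * (vy p).im + (v p).im * (vyy p).im))) (L := L)
    hf hH hg hfg hgper (by fun_prop) (by fun_prop) (by fun_prop) ?_ ?_ ?_
  · simp only [rellichFlux, zero_mul, sub_zero]
    rw [key]
    refine intervalIntegral.integral_congr fun x _ => ?_
    refine intervalIntegral.integral_congr fun y hy => ?_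
    have hp : ((x, y) : ℝ × ℝ) ∈ epi f := uIcc_subset_Ioi_of_lt (hfg x) (hH x) hy
    simp only [Complex.sq_norm, Complex.normSq_apply]
    linear_combination (2 * y * (vy (x, y)).re + (v (x, y)).re) * hv.helmholtz_re hp +
      (2 * y * (vy (x, y)).im + (v (x, y)).im) * hv.helmholtz_im hp
  · intro p hp
    convert! ((((d21 p hp).complex_re.mul (d11 p hp).complex_re).add
      ((d21 p hp).complex_im.mul (d11 p hp).complex_im)).const_mul (2 * p.2)).add
      (((d1 p hp).complex_re.mul (d11 p hp).complex_re).add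
      ((d1 p hp).complex_im.mul (d11 p hp).complex_im)) using 1
  · intro p hp
    convert! ((hasDerivAt_id p.2).mul ((((((d22 p hp).complex_re.pow 2).add
      ((d22 p hp).complex_im.pow 2))).sub
      (((d12 p hp).complex_re.pow 2).add ((d12 p hp).complex_im.pow 2))).add
      ((((d2 p hp).complex_re.pow 2).add ((d2 p hp).complex_im.pow 2)).const_mul (k ^ 2)))).add
      (((d2 p hp).complex_re.mul (d22 p hp).complex_re).add
      ((d2 p hp).complex_im.mul (d22 p hp).complex_im)) using 1
    simp [-mul_eq_mul_left_iff]
    ring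
  · intro p hp
    simp only [q0 p hp, q1 p hp, q2 p hp, Complex.mul_re, Complex.mul_im]
    linear_combination (2 * p.2 * ((vy p).re * (vx p).re + (vy p).im * (vx p).im) +
      ((v p).re * (vx p).re + (v p).im * (vx p).im)) * re_sq_add_im_sq hν

end Identities

section Difference

variable {E : Type*} [NormedAddCommGroup E] [NormedSpace ℝ E]

/-- The upward difference quotient in the second variable. -/
noncomputable def upDiff (ε : ℝ) (g : ℝ × ℝ → E) (p : ℝ × ℝ) : E :=
  ε⁻¹ • (g (p.1, p.2 + ε) - g p)

variable {f : ℝ → ℝ} {ε H : ℝ} {g : ℝ × ℝ → E}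

theorem add_mem_epi (hε : 0 ≤ ε) {p : ℝ × ℝ} (hp : p ∈ epi f) : (p.1, p.2 + ε) ∈ epi f :=
  lt_of_lt_of_le (b := p.2) hp (le_add_of_nonneg_right hε)

theorem continuousOn_upDiff (hε : 0 ≤ ε) (hg : ContinuousOn g (epi f)) :
    ContinuousOn (upDiff ε g) (epi f) :=
  ((hg.comp (by fun_prop) fun _ hp => add_mem_epi hε hp).sub hg).const_smul _

theorem hasDerivAt_upDiff_fst {gx : ℝ × ℝ → E} (hε : 0 ≤ ε)
    (hd : ∀ p ∈ epi f, HasDerivAt (fun t => g (t, p.2)) (gx p) p.1) {p : ℝ × ℝ} (hp : p ∈ epi f) :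
    HasDerivAt (fun t => upDiff ε g (t, p.2)) (upDiff ε gx p) p.1 :=
  ((hd _ (add_mem_epi hε hp)).sub (hd p hp)).const_smul _

theorem hasDerivAt_upDiff_snd {gy : ℝ × ℝ → E} (hε : 0 ≤ ε)
    (hd : ∀ p ∈ epi f, HasDerivAt (fun t => g (p.1, t)) (gy p) p.2) {p : ℝ × ℝ} (hp : p ∈ epi f) :
    HasDerivAt (fun t => upDiff ε g (p.1, t)) (upDiff ε gy p) p.2 :=
  (((hd _ (add_mem_epi hε hp)).comp_add_const p.2 ε).sub (hd p hp)).const_smul _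

theorem upDiff_eq_mean [CompleteSpace E] {gy : ℝ × ℝ → E} (hε : 0 ≤ ε)
    (hgy : ContinuousOn gy (epi f))
    (hd : ∀ p ∈ epi f, HasDerivAt (fun t => g (p.1, t)) (gy p) p.2) {p : ℝ × ℝ} (hp : p ∈ epi f) :
    upDiff ε g p = ε⁻¹ • ∫ r in p.2..(p.2 + ε), gy (p.1, r) := by
  have hp' : f p.1 < p.2 + ε := add_mem_epi hε hp
  rw [upDiff, intervalIntegral.integral_eq_sub_of_hasDerivAt (f := fun t => g (p.1, t))
    (fun r hr => hd (p.1, r) (uIcc_subset_Ioi_of_lt hp hp' hr))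
    (intervalIntegrable_vertical hgy hp hp')]

theorem norm_mean_le {h : ℝ → E} {C y : ℝ} (hε : 0 < ε) (hC : ∀ r ∈ Icc y (y + ε), ‖h r‖ ≤ C) :
    ‖ε⁻¹ • ∫ r in y..(y + ε), h r‖ ≤ C := by
  have h1 : ‖∫ r in y..(y + ε), h r‖ ≤ C * |y + ε - y| :=
    intervalIntegral.norm_integral_le_of_norm_le_const fun r hr => hC r (by
      rw [uIoc_of_le (by linarith)] at hr
      exact Ioc_subset_Icc_self hr)
  rw [add_sub_cancel_left, abs_of_pos hε] at h1
  rw [norm_smul, norm_inv, Real.norm_of_nonneg hε.le, inv_mul_le_iff₀ hε]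
  linarith

theorem tendsto_mean [CompleteSpace E] {h : ℝ → E} {a y : ℝ} (hh : ContinuousOn h (Ici a))
    (hy : a ≤ y) {z : ℝ → ℝ} (hz : Tendsto z (𝓝[>] 0) (𝓝 y)) (hyz : ∀ ε > 0, y ≤ z ε) :
    Tendsto (fun ε => ε⁻¹ • ∫ r in (z ε)..(z ε + ε), h r) (𝓝[>] 0) (𝓝 (h y)) := by
  rw [Metric.tendsto_nhds]
  intro η hη
  obtain ⟨δ, hδ, hδh⟩ := Metric.continuousOn_iff.1 hh y hy (η / 2) (by linarith)
  have h1 : ∀ᶠ ε in 𝓝[>] (0 : ℝ), ε < δ / 2 :=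
    mem_nhdsWithin_of_mem_nhds (Iio_mem_nhds (by linarith))
  filter_upwards [h1, self_mem_nhdsWithin, hz.eventually (Metric.ball_mem_nhds y (half_pos hδ))]
    with ε hεδ hε hzε
  have hε : 0 < ε := hε
  have hz' : z ε - y < δ / 2 := (le_abs_self _).trans_lt (by simpa [Real.dist_eq] using hzε)
  have hint : IntervalIntegrable h volume (z ε) (z ε + ε) :=
    (hh.mono fun r hr => by
      rw [uIcc_of_le (by linarith)] at hr
      exact hy.trans ((hyz ε hε).trans hr.1)).intervalIntegrable
  have hkey : (ε⁻¹ • ∫ r in (z ε)..(z ε + ε), h r) - h y =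
      ε⁻¹ • ∫ r in (z ε)..(z ε + ε), (h r - h y) := by
    rw [intervalIntegral.integral_sub hint (by simp), intervalIntegral.integral_const,
      add_sub_cancel_left, smul_sub, smul_smul, inv_mul_cancel₀ hε.ne', one_smul]
  rw [dist_eq_norm, hkey]
  refine (norm_mean_le (C := η / 2) hε fun r hr => ?_).trans_lt (by linarith)
  have hyr : y ≤ r := (hyz ε hε).trans hr.1
  rw [← dist_eq_norm]
  refine (hδh r (hy.trans hyr) ?_).le
  rw [Real.dist_eq, abs_of_nonneg (by linarith)]
  linarith [hr.2]

end Difference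

section Regularization

variable {f : ℝ → ℝ} {ε k H L : ℝ} {ν : ℂ} {u ux uy uxx uyy : ℝ × ℝ → ℂ}

theorem prim_quasi {g : ℝ × ℝ → ℂ} (hH : ∀ x, f x < H)
    (hq : ∀ p ∈ epi f, g (p.1 + L, p.2) = ν * g p) {p : ℝ × ℝ} (hp : p ∈ epi f) :
    prim H g (p.1 + L, p.2) = ν * prim H g p := by
  rw [prim, prim, ← intervalIntegral.integral_const_mul]
  exact intervalIntegral.integral_congr fun r hr =>
    hq (p.1, r) (uIcc_subset_Ioi_of_lt (hH _) hp hr)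

theorem upDiff_quasi {g : ℝ × ℝ → ℂ} (hε : 0 ≤ ε)
    (hq : ∀ p ∈ epi f, g (p.1 + L, p.2) = ν * g p) {p : ℝ × ℝ} (hp : p ∈ epi f) :
    upDiff ε g (p.1 + L, p.2) = ν * upDiff ε g p := by
  have h := hq _ (add_mem_epi hε hp)
  simp only at h
  simp only [upDiff, h, hq p hp, Complex.real_smul]
  ring

/-- Averaging a solution over short vertical segments yields a solution with continuous mixed
second derivatives. -/
theorem IsSolution.isRegularSolution_upDiff (hu : IsSolution f k L ν u ux uy uxx uyy)
    (hf : Continuous f) (hH : ∀ x, f x < H) (hε : 0 ≤ ε) :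
    IsRegularSolution f k L ν (upDiff ε (prim H u)) (upDiff ε (prim H ux)) (upDiff ε u)
      (upDiff ε (prim H uxx)) (upDiff ε ux) (upDiff ε uy) := by
  have hsub := epi_subset_epiClosed f
  have c0 := hu.cont.mono hsub
  have c1 := hu.cont_x.mono hsub
  have c2 := hu.cont_y.mono hsub
  have dx : ∀ p ∈ epi f, _ := fun p hp => hu.deriv_x p (hsub hp)
  have dy : ∀ p ∈ epi f, _ := fun p hp => hu.deriv_y p (hsub hp)
  refine ⟨continuousOn_upDiff hε (continuousOn_prim hf hH c0),
    continuousOn_upDiff hε (continuousOn_prim hf hH c1), continuousOn_upDiff hε c0,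
    continuousOn_upDiff hε (continuousOn_prim hf hH hu.cont_xx), continuousOn_upDiff hε c1,
    continuousOn_upDiff hε c2,
    fun p hp => hasDerivAt_upDiff_fst hε (fun q hq => hasDerivAt_prim_fst hf hH c0 c1 dx hq) hp,
    fun p hp => hasDerivAt_upDiff_snd hε (fun q hq => hasDerivAt_prim_snd hH c0 hq) hp,
    fun p hp => hasDerivAt_upDiff_fst hε
      (fun q hq => hasDerivAt_prim_fst hf hH c1 hu.cont_xx hu.deriv_xx hq) hp,
    fun p hp => hasDerivAt_upDiff_snd hε (fun q hq => hasDerivAt_prim_snd hH c1 hq) hp,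
    fun p hp => hasDerivAt_upDiff_fst hε dx hp,
    fun p hp => hasDerivAt_upDiff_snd hε dy hp, fun p hp => ?_,
    fun p hp => upDiff_quasi hε
      (fun q hq => prim_quasi hH (fun r hr => hu.quasi r (hsub hr)) hq) hp,
    fun p hp => upDiff_quasi hε (fun q hq => prim_quasi hH (fun r hr => hu.quasi_x r (hsub hr)) hq)
      hp,
    fun p hp => upDiff_quasi hε (fun r hr => hu.quasi r (hsub hr)) hp⟩
  have hp' : f p.1 < p.2 + ε := add_mem_epi hε hp
  rw [upDiff_eq_mean hε hu.cont_xx (fun q hq => hasDerivAt_prim_snd hH hu.cont_xx hq) hp,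
    upDiff_eq_mean hε hu.cont_yy hu.deriv_yy hp,
    upDiff_eq_mean hε c0 (fun q hq => hasDerivAt_prim_snd hH c0 hq) hp, ← smul_add,
    mul_smul_comm, ← smul_add, ← intervalIntegral.integral_const_mul,
    ← intervalIntegral.integral_add (intervalIntegrable_vertical hu.cont_xx hp hp')
      (intervalIntegrable_vertical hu.cont_yy hp hp'),
    ← intervalIntegral.integral_add ((intervalIntegrable_vertical hu.cont_xx hp hp').add
      (intervalIntegrable_vertical hu.cont_yy hp hp'))
      ((intervalIntegrable_vertical c0 hp hp').const_mul _),
    intervalIntegral.integral_zero_ae, smul_zero]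
  exact .of_forall fun r hr => hu.helmholtz (p.1, r)
    (uIcc_subset_Ioi_of_lt hp hp' (uIoc_subset_uIcc hr))

end Regularization

section Boundary

variable {E : Type*} [NormedAddCommGroup E] [NormedSpace ℝ E]

theorem norm_sub_sub_smul_le {w w' : ℝ → E} {a b η : ℝ} {B : E}
    (hw : ∀ t ∈ uIcc a b, HasDerivAt w (w' t) t) (hB : ∀ t ∈ uIcc a b, ‖w' t - B‖ ≤ η) :
    ‖w b - w a - (b - a) • B‖ ≤ η * |b - a| := by
  have h := Convex.norm_image_sub_le_of_norm_hasDerivWithin_le (f := fun t => w t - t • B)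
    (f' := fun t => w' t - B) (s := uIcc a b) (C := η)
    (fun t ht => by
      have h1 := (hw t ht).sub ((hasDerivAt_id t).smul_const B)
      rw [one_smul] at h1
      exact h1.hasDerivWithinAt)
    hB (convex_uIcc a b) left_mem_uIcc right_mem_uIcc
  rw [Real.norm_eq_abs] at h
  convert h using 2
  rw [sub_smul]
  abel

/-- If `u` vanishes on a Lipschitz graph and is continuously differentiable up to it, then its
tangential derivative vanishes wherever the graph has a tangent. -/
theorem tangential_deriv_eq_zero {f : ℝ → ℝ} {K : NNReal} (hf : LipschitzWith K f)
    {u ux uy : ℝ × ℝ → E} (cx : ContinuousOn ux (epiClosed f)) (cy : ContinuousOn uy (epiClosed f))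
    (dx : ∀ p ∈ epiClosed f, HasDerivAt (fun t => u (t, p.2)) (ux p) p.1)
    (dy : ∀ p ∈ epiClosed f, HasDerivAt (fun t => u (p.1, t)) (uy p) p.2)
    (h0 : ∀ x, u (x, f x) = 0) {x₀ d : ℝ} (hd : HasDerivAt f d x₀) :
    ux (x₀, f x₀) + d • uy (x₀, f x₀) = 0 := by
  set A := ux (x₀, f x₀) with hA
  set B := uy (x₀, f x₀) with hB
  have hp₀ : ((x₀, f x₀) : ℝ × ℝ) ∈ epiClosed f := le_refl (f x₀)
  have hR : HasDerivAt (fun x => (x - x₀) • A + (f x - f x₀) • B) (A + d • B) x₀ := by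
    have h := (((hasDerivAt_id x₀).sub_const x₀).smul_const A).add
      ((hd.sub_const (f x₀)).smul_const B)
    rw [one_smul] at h
    exact h
  refine hR.unique ?_
  rw [hasDerivAt_iff_isLittleO, Asymptotics.isLittleO_iff]
  intro c hc
  have hK : (0 : ℝ) ≤ K := K.2
  set η := c / (3 * K + 1) with hη
  have hη0 : 0 < η := by positivity
  obtain ⟨δ₁, hδ₁, h1⟩ := Metric.continuousOn_iff.1 cx _ hp₀ η hη0
  obtain ⟨δ₂, hδ₂, h2⟩ := Metric.continuousOn_iff.1 cy _ hp₀ η hη0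
  have hev : ∀ᶠ x in 𝓝 x₀, |x - x₀| < min δ₁ δ₂ / (K + 1) := by
    have := Metric.ball_mem_nhds x₀ (ε := min δ₁ δ₂ / (K + 1)) (by positivity)
    filter_upwards [this] with x hx
    simpa [Real.dist_eq] using hx
  filter_upwards [hev] with x hx
  rw [lt_div_iff₀ (by positivity)] at hx
  set s := |x - x₀| with hs
  have hs0 : 0 ≤ s := abs_nonneg _
  set z := f x₀ + K * s with hz
  have hlip : ∀ a b, |f a - f b| ≤ K * |a - b| := fun a b => by
    simpa [Real.dist_eq] using hf.dist_le_mul a b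
  have hfx := abs_le.1 (hlip x x₀)
  have hKs : 0 ≤ K * s := by positivity
  have hclose : ∀ a b, |a - x₀| ≤ s → |b - f x₀| ≤ K * s → f a ≤ b →
      ‖ux (a, b) - A‖ ≤ η ∧ ‖uy (a, b) - B‖ ≤ η := by
    intro a b ha hb hab
    have hdist : dist ((a, b) : ℝ × ℝ) (x₀, f x₀) < min δ₁ δ₂ := by
      rw [Prod.dist_eq, Real.dist_eq, Real.dist_eq]
      refine max_lt ?_ ?_ <;> nlinarith
    rw [← dist_eq_norm, ← dist_eq_norm]
    exact ⟨(h1 _ hab (hdist.trans_le (min_le_left _ _))).le,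
      (h2 _ hab (hdist.trans_le (min_le_right _ _))).le⟩
  have hxz : f x ≤ z := by linarith [hfx.2]
  have e1 := norm_sub_sub_smul_le (w := fun t => u (x₀, t)) (w' := fun t => uy (x₀, t))
    (a := f x₀) (b := z) (B := B) (η := η)
    (fun t ht => dy (x₀, t) (by rw [uIcc_of_le (by linarith)] at ht; exact ht.1))
    (fun t ht => by
      rw [uIcc_of_le (by linarith)] at ht
      exact (hclose x₀ t (by simpa using hs0)
        (abs_le.2 ⟨by linarith [ht.1], by linarith [ht.2]⟩) ht.1).2)
  have hmid : ∀ t ∈ uIcc x₀ x, |t - x₀| ≤ s := fun t ht => abs_sub_left_of_mem_uIcc ht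
  have hmid' : ∀ t ∈ uIcc x₀ x, f t ≤ z := fun t ht => by
    have := (abs_le.1 (hlip t x₀)).2
    have := mul_le_mul_of_nonneg_left (hmid t ht) hK
    linarith
  have e2 := norm_sub_sub_smul_le (w := fun t => u (t, z)) (w' := fun t => ux (t, z))
    (a := x₀) (b := x) (B := A) (η := η)
    (fun t ht => dx (t, z) (hmid' t ht))
    (fun t ht => (hclose t z (hmid t ht)
        (abs_le.2 ⟨by linarith, by linarith⟩) (hmid' t ht)).1)
  have e3 := norm_sub_sub_smul_le (w := fun t => u (x, t)) (w' := fun t => uy (x, t))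
    (a := z) (b := f x) (B := B) (η := η)
    (fun t ht => dy (x, t) (by rw [uIcc_of_ge hxz] at ht; exact ht.1))
    (fun t ht => by
      rw [uIcc_of_ge hxz] at ht
      exact (hclose x t le_rfl
        (abs_le.2 ⟨by linarith [ht.1, hfx.1], by linarith [ht.2]⟩) ht.1).2)
  simp only [h0] at e1 e3
  have hsum : (x - x₀) • A + (f x - f x₀) • B - ((x₀ - x₀) • A + (f x₀ - f x₀) • B) -
      (x - x₀) • (0 : E) = -((u (x₀, z) - 0 - (z - f x₀) • B) +
        (u (x, z) - u (x₀, z) - (x - x₀) • A) + (0 - u (x, z) - (f x - z) • B)) := by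
    module
  rw [hsum, norm_neg, Real.norm_eq_abs]
  have a1 : |z - f x₀| = K * s := by rw [hz, add_sub_cancel_left, abs_of_nonneg hKs]
  have a3 : |f x - z| ≤ 2 * (K * s) := by
    rw [abs_le]
    constructor <;> linarith [hfx.1]
  have hc' : η * (3 * K + 1) = c := div_mul_cancel₀ _ (by positivity)
  calc _ ≤ η * |z - f x₀| + η * |x - x₀| + η * |f x - z| :=
        (norm_add₃_le).trans (add_le_add (add_le_add e1 e2) e3)
    _ ≤ η * (K * s) + η * s + η * (2 * (K * s)) := by rw [a1]; gcongr
    _ = η * (3 * K + 1) * s := by ring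
    _ = c * |x - x₀| := by rw [hc']

end Boundary

section Limits

theorem intervalIntegrable_comp_of_bounded {T : Type*} [NormedAddCommGroup T] [ProperSpace T]
    {F : T → ℝ} (hF : Continuous F) {a b C : ℝ} {X : ℝ → T}
    (hm : AEStronglyMeasurable X (volume.restrict (uIoc a b)))
    (hb : ∀ x ∈ uIoc a b, ‖X x‖ ≤ C) : IntervalIntegrable (fun x => F (X x)) volume a b := by
  obtain ⟨B, hB⟩ := (isCompact_closedBall (0 : T) C).exists_bound_of_continuousOn hF.continuousOn
  refine (intervalIntegrable_const (c := B)).mono_fun (hF.comp_aestronglyMeasurable hm) ?_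
  filter_upwards [ae_restrict_mem measurableSet_uIoc] with x hx
  exact (hB _ (mem_closedBall_zero_iff.2 (hb x hx))).trans (le_abs_self B)

theorem tendsto_integral_comp_of_bounded {T : Type*} [NormedAddCommGroup T] [ProperSpace T]
    {F : T → ℝ} (hF : Continuous F) {a b C : ℝ} {X : ℝ → ℝ → T} {X₀ : ℝ → T}
    {l : Filter ℝ} [l.IsCountablyGenerated]
    (hm : ∀ᶠ ε in l, AEStronglyMeasurable (X ε) (volume.restrict (uIoc a b)))
    (hb : ∀ᶠ ε in l, ∀ x ∈ uIoc a b, ‖X ε x‖ ≤ C)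
    (ht : ∀ x ∈ uIoc a b, Tendsto (fun ε => X ε x) l (𝓝 (X₀ x))) :
    Tendsto (fun ε => ∫ x in a..b, F (X ε x)) l (𝓝 (∫ x in a..b, F (X₀ x))) := by
  obtain ⟨B, hB⟩ := (isCompact_closedBall (0 : T) C).exists_bound_of_continuousOn hF.continuousOn
  refine intervalIntegral.tendsto_integral_filter_of_dominated_convergence (fun _ => B)
    (hm.mono fun ε h => hF.comp_aestronglyMeasurable h) ?_ intervalIntegrable_const
    (ae_of_all _ fun x hx => (hF.tendsto _).comp (ht x hx))
  exact hb.mono fun ε h => ae_of_all _ fun x hx => hB _ (mem_closedBall_zero_iff.2 (h x hx))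

variable {f : ℝ → ℝ} {k H L : ℝ} {K : NNReal} {ν : ℂ} {u ux uy uxx uyy : ℝ × ℝ → ℂ}

theorem exists_bound_above_graph (hpos : ∀ x, 0 ≤ f x) (hf : Continuous f) {g : ℝ × ℝ → ℂ}
    (hg : ContinuousOn g (epiClosed f)) (L H : ℝ) :
    ∃ C, ∀ p ∈ epiClosed f, p.1 ∈ Icc 0 L → p.2 ≤ H → ‖g p‖ ≤ C := by
  have hcomp : IsCompact ((Icc 0 L ×ˢ Icc 0 H) ∩ epiClosed f) :=
    (isCompact_Icc.prod isCompact_Icc).inter_right (isClosed_epiClosed hf)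
  obtain ⟨C, hC⟩ := hcomp.exists_bound_of_continuousOn (hg.mono inter_subset_right)
  exact ⟨C, fun p hp h1 h2 => hC p ⟨⟨h1, (hpos p.1).trans hp, h2⟩, hp⟩⟩

/-- The value and the first derivatives of a solution averaged over vertical segments. -/
noncomputable def avgData (H : ℝ) (u ux : ℝ × ℝ → ℂ) (ε : ℝ) (p : ℝ × ℝ) : ℂ × ℂ × ℂ :=
  (upDiff ε (prim H u) p, upDiff ε (prim H ux) p, upDiff ε u p)

theorem IsSolution.continuousOn_avgData (hu : IsSolution f k L ν u ux uy uxx uyy)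
    (hf : Continuous f) (hH : ∀ x, f x < H) {ε : ℝ} (hε : 0 ≤ ε) :
    ContinuousOn (avgData H u ux ε) (epi f) :=
  have h := hu.isRegularSolution_upDiff hf hH hε
  h.cont.prodMk (h.cont_x.prodMk h.cont_y)

theorem IsSolution.avgData_eq (hu : IsSolution f k L ν u ux uy uxx uyy)
    (hH : ∀ x, f x < H) {ε : ℝ} (hε : 0 ≤ ε) {p : ℝ × ℝ} (hp : p ∈ epi f) :
    avgData H u ux ε p = (ε⁻¹ • ∫ r in p.2..(p.2 + ε), u (p.1, r),
      ε⁻¹ • ∫ r in p.2..(p.2 + ε), ux (p.1, r), ε⁻¹ • ∫ r in p.2..(p.2 + ε), uy (p.1, r)) := by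
  have hsub := epi_subset_epiClosed f
  have c0 := hu.cont.mono hsub
  have c1 := hu.cont_x.mono hsub
  rw [avgData, upDiff_eq_mean hε c0 (fun q hq => hasDerivAt_prim_snd hH c0 hq) hp,
    upDiff_eq_mean hε c1 (fun q hq => hasDerivAt_prim_snd hH c1 hq) hp,
    upDiff_eq_mean hε (hu.cont_y.mono hsub) (fun q hq => hu.deriv_y q (hsub hq)) hp]

theorem IsSolution.exists_bound_avgData (hu : IsSolution f k L ν u ux uy uxx uyy)
    (hpos : ∀ x, 0 ≤ f x) (hf : Continuous f) (hH : ∀ x, f x < H) :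
    ∃ C, ∀ ε ∈ Ioo (0 : ℝ) 1, ∀ p ∈ epi f, p.1 ∈ Icc 0 L → p.2 ≤ H + 1 →
      ‖avgData H u ux ε p‖ ≤ C := by
  obtain ⟨C₀, h₀⟩ := exists_bound_above_graph hpos hf hu.cont L (H + 2)
  obtain ⟨C₁, h₁⟩ := exists_bound_above_graph hpos hf hu.cont_x L (H + 2)
  obtain ⟨C₂, h₂⟩ := exists_bound_above_graph hpos hf hu.cont_y L (H + 2)
  refine ⟨max C₀ (max C₁ C₂), fun ε hε p hp hp1 hp2 => ?_⟩
  rw [hu.avgData_eq hH hε.1.le hp]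
  have key : ∀ {g : ℝ × ℝ → ℂ} {C : ℝ},
      (∀ q ∈ epiClosed f, q.1 ∈ Icc 0 L → q.2 ≤ H + 2 → ‖g q‖ ≤ C) →
      ‖ε⁻¹ • ∫ r in p.2..(p.2 + ε), g (p.1, r)‖ ≤ C := fun hg =>
    norm_mean_le hε.1 fun r hr => hg (p.1, r) ((le_of_lt hp).trans hr.1) hp1
      (by have := hr.2; have := hε.2; simp only; linarith)
  exact max_le_max (key h₀) (max_le_max (key h₁) (key h₂))

theorem IsSolution.tendsto_avgData (hu : IsSolution f k L ν u ux uy uxx uyy)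
    (hH : ∀ x, f x < H) {x y : ℝ} (hy : f x ≤ y) {z : ℝ → ℝ}
    (hz : Tendsto z (𝓝[>] 0) (𝓝 y)) (hyz : ∀ ε > 0, y ≤ z ε) (hfz : ∀ ε > 0, f x < z ε) :
    Tendsto (fun ε => avgData H u ux ε (x, z ε)) (𝓝[>] 0) (𝓝 (u (x, y), ux (x, y), uy (x, y))) := by
  have hv : ∀ {g : ℝ × ℝ → ℂ}, ContinuousOn g (epiClosed f) →
      ContinuousOn (fun r => g (x, r)) (Ici (f x)) := fun hg =>
    hg.comp (by fun_prop) fun r hr => hr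
  refine Tendsto.congr' (f₁ := fun ε => (ε⁻¹ • ∫ r in (z ε)..(z ε + ε), u (x, r),
      ε⁻¹ • ∫ r in (z ε)..(z ε + ε), ux (x, r), ε⁻¹ • ∫ r in (z ε)..(z ε + ε), uy (x, r))) ?_ ?_
  · filter_upwards [self_mem_nhdsWithin] with ε hε
    exact (hu.avgData_eq hH (le_of_lt hε) (p := (x, z ε)) (hfz ε hε)).symm
  · exact (tendsto_mean (hv hu.cont) hy hz hyz).prodMk_nhds
      ((tendsto_mean (hv hu.cont_x) hy hz hyz).prodMk_nhds
        (tendsto_mean (hv hu.cont_y) hy hz hyz))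

/-- The data entering the flux identities for the averaged solution above the graph of
`f + ε`. -/
noncomputable def stripData (H : ℝ) (f : ℝ → ℝ) (u ux : ℝ × ℝ → ℂ) (ε x : ℝ) :
    (ℂ × ℂ × ℂ) × (ℝ × ℝ) × (ℂ × ℂ × ℂ) :=
  (avgData H u ux ε (x, H), (deriv f x, f x + ε), avgData H u ux ε (x, f x + ε))

/-- The limit of `stripData` as the averaging parameter tends to zero. -/
noncomputable def stripData₀ (H : ℝ) (f : ℝ → ℝ) (u ux uy : ℝ × ℝ → ℂ) (x : ℝ) :
    (ℂ × ℂ × ℂ) × (ℝ × ℝ) × (ℂ × ℂ × ℂ) :=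
  ((u (x, H), ux (x, H), uy (x, H)), (deriv f x, f x),
    (u (x, f x), ux (x, f x), uy (x, f x)))

theorem IsSolution.tendsto_integral_stripData (hu : IsSolution f k L ν u ux uy uxx uyy)
    (hL : 0 ≤ L) (hpos : ∀ x, 0 ≤ f x) (hf : LipschitzWith K f) (hH : ∀ x, f x < H)
    {F : (ℂ × ℂ × ℂ) × (ℝ × ℝ) × (ℂ × ℂ × ℂ) → ℝ} (hF : Continuous F) :
    Tendsto (fun ε => ∫ x in (0 : ℝ)..L, F (stripData H f u ux ε x)) (𝓝[>] 0)
      (𝓝 (∫ x in (0 : ℝ)..L, F (stripData₀ H f u ux uy x))) := by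
  have hfc := hf.continuous
  have hev : ∀ᶠ ε in 𝓝[>] (0 : ℝ), ε ∈ Ioo (0 : ℝ) 1 := Ioo_mem_nhdsGT one_pos
  obtain ⟨C, hC⟩ := hu.exists_bound_avgData hpos hfc hH
  refine tendsto_integral_comp_of_bounded (C := max C (max (max (K : ℝ) (H + 1)) C)) hF ?_ ?_ ?_
  · filter_upwards [hev] with ε hε
    have hc := hu.continuousOn_avgData hfc hH hε.1.le
    have h1 : Continuous fun x => avgData H u ux ε (x, H) :=
      hc.comp_continuous (by fun_prop) hH
    have h2 : Continuous fun x => avgData H u ux ε (x, f x + ε) :=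
      hc.comp_continuous (by fun_prop) fun x => lt_add_of_pos_right (f x) hε.1
    exact h1.aestronglyMeasurable.prodMk (((measurable_deriv f).aestronglyMeasurable.prodMk
      (hfc.add_const ε).aestronglyMeasurable).prodMk h2.aestronglyMeasurable)
  · filter_upwards [hev] with ε hε x hx
    rw [uIoc_of_le hL] at hx
    have hx' := Ioc_subset_Icc_self hx
    refine max_le_max (hC ε hε _ (hH x) hx' (by simp)) (max_le_max (max_le_max
      (norm_deriv_le_of_lipschitz hf) ?_) (hC ε hε _ (lt_add_of_pos_right (f x) hε.1) hx' ?_))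
    · change ‖f x + ε‖ ≤ H + 1
      rw [Real.norm_of_nonneg (add_nonneg (hpos x) hε.1.le)]
      linarith [hH x, hε.2]
    · linarith [hH x, hε.2]
  · intro x _
    have hε0 : Tendsto (fun ε : ℝ => ε) (𝓝[>] 0) (𝓝 0) := tendsto_nhdsWithin_of_tendsto_nhds
      tendsto_id
    have hfε : Tendsto (fun ε : ℝ => f x + ε) (𝓝[>] 0) (𝓝 (f x)) := by
      simpa using hε0.const_add (f x)
    refine (hu.tendsto_avgData hH (hH x).le tendsto_const_nhds (fun _ _ => le_rfl)
      fun _ _ => hH x).prodMk_nhds ((tendsto_const_nhds.prodMk_nhds hfε).prodMk_nhds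
        (hu.tendsto_avgData hH le_rfl hfε (fun ε hε => ?_) fun ε hε => ?_))
    · exact (lt_add_of_pos_right (f x) hε).le
    · exact lt_add_of_pos_right (f x) hε

theorem lipschitzWith_add_const (hf : LipschitzWith K f) (ε : ℝ) :
    LipschitzWith K fun x => f x + ε := fun x y => by
  rw [edist_add_right]
  exact hf x y

/-- No energy escapes through the line `y = H`. -/
theorem IsSolution.integral_energyFlux_eq_zero (hu : IsSolution f k L ν u ux uy uxx uyy)
    (hL : 0 ≤ L) (hν : ‖ν‖ = 1) (hpos : ∀ x, 0 ≤ f x) (hf : LipschitzWith K f)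
    (hper : ∀ x, f (x + L) = f x) (hH : ∀ x, f x < H) (h0 : ∀ x, u (x, f x) = 0) :
    ∫ x in (0 : ℝ)..L, energyFlux 0 (u (x, H)) (ux (x, H)) (uy (x, H)) = 0 := by
  have hlim := hu.tendsto_integral_stripData hL hpos hf hH
    (F := fun q => energyFlux 0 q.1.1 q.1.2.1 q.1.2.2 -
      energyFlux q.2.1.1 q.2.2.1 q.2.2.2.1 q.2.2.2.2) (by unfold energyFlux; fun_prop)
  have hzero : ∀ x, energyFlux (deriv f x) (u (x, f x)) (ux (x, f x)) (uy (x, f x)) = 0 := by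
    intro x
    simp [energyFlux, h0]
  simp only [stripData₀, hzero, sub_zero] at hlim
  refine tendsto_nhds_unique hlim (tendsto_const_nhds.congr' ?_)
  filter_upwards [self_mem_nhdsWithin] with ε hε
  have hε : 0 < ε := hε
  have h := (hu.isRegularSolution_upDiff hf.continuous hH hε.le).energy_identity hν hf.continuous
    hH (lipschitzWith_add_const hf ε) (fun x => lt_add_of_pos_right _ hε)
    (fun x => by rw [hper])
  simp only [deriv_add_const] at h
  exact h.symm

theorem IsSolution.rellichFlux_graph_nonneg (hu : IsSolution f k L ν u ux uy uxx uyy)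
    (hpos : ∀ x, 0 ≤ f x) (hf : LipschitzWith K f) (h0 : ∀ x, u (x, f x) = 0) {x : ℝ}
    (hx : DifferentiableAt ℝ f x) :
    0 ≤ rellichFlux k (deriv f x) (f x) (u (x, f x)) (ux (x, f x)) (uy (x, f x)) := by
  have ht := tangential_deriv_eq_zero hf hu.cont_x hu.cont_y hu.deriv_x hu.deriv_y h0
    hx.hasDerivAt
  rw [eq_neg_of_add_eq_zero_left ht, h0]
  have : 0 ≤ f x * (1 + deriv f x ^ 2) * ((uy (x, f x)).re ^ 2 + (uy (x, f x)).im ^ 2) :=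
    mul_nonneg (mul_nonneg (hpos x) (by positivity)) (by positivity)
  refine this.trans_eq ?_
  simp only [rellichFlux, Complex.real_smul, Complex.neg_re, Complex.neg_im, Complex.re_ofReal_mul,
    Complex.im_ofReal_mul, Complex.zero_re, Complex.zero_im]
  ring

theorem IsSolution.tendsto_integral_vertical_energy (hu : IsSolution f k L ν u ux uy uxx uyy)
    (hL : 0 ≤ L) (hpos : ∀ x, 0 ≤ f x) (hf : Continuous f) (hH : ∀ x, f x < H) {t : ℝ}
    (ht : 0 < t) (htH : ∀ x, f x + t ≤ H) :
    Tendsto (fun ε => ∫ x in (0 : ℝ)..L, ∫ y in (f x + t)..H, 2 * ‖upDiff ε u (x, y)‖ ^ 2)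
      (𝓝[>] 0) (𝓝 (∫ x in (0 : ℝ)..L, ∫ y in (f x + t)..H, 2 * ‖uy (x, y)‖ ^ 2)) := by
  obtain ⟨C, hC⟩ := hu.exists_bound_avgData hpos hf hH
  have hev : ∀ᶠ ε in 𝓝[>] (0 : ℝ), ε ∈ Ioo (0 : ℝ) 1 := Ioo_mem_nhdsGT one_pos
  have hcont : ∀ ε ∈ Ioo (0 : ℝ) 1, ContinuousOn (upDiff ε u) (epi f) := fun ε hε =>
    continuousOn_upDiff hε.1.le (hu.cont.mono (epi_subset_epiClosed f))
  have hbd : ∀ ε ∈ Ioo (0 : ℝ) 1, ∀ x ∈ uIoc 0 L, ∀ y ∈ uIoc (f x + t) H,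
      ‖upDiff ε u (x, y)‖ ≤ C := fun ε hε x hx y hy => by
    rw [uIoc_of_le hL] at hx
    rw [uIoc_of_le (htH x)] at hy
    have h := hC ε hε (x, y) (by change f x < y; linarith [hy.1]) (Ioc_subset_Icc_self hx)
      (by linarith [hy.2])
    exact ((le_max_right _ _).trans (le_max_right _ _)).trans h
  refine tendsto_integral_comp_of_bounded (F := fun s => s) (C := 2 * C ^ 2 * H)
    (X := fun ε x => ∫ y in (f x + t)..H, 2 * ‖upDiff ε u (x, y)‖ ^ 2)
    continuous_id ?_ ?_ ?_
  · filter_upwards [hev] with ε hε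
    exact (continuous_integral_above_graph hf hH (by fun_prop)
      (fun x => lt_add_of_pos_right (f x) ht)
      (continuousOn_const.mul ((hcont ε hε).norm.pow 2))).aestronglyMeasurable
  · filter_upwards [hev] with ε hε x hx
    have h := intervalIntegral.norm_integral_le_of_norm_le_const (a := f x + t) (b := H)
      (f := fun y => 2 * ‖upDiff ε u (x, y)‖ ^ 2) (C := 2 * C ^ 2) fun y hy => by
        rw [Real.norm_of_nonneg (by positivity)]
        have := hbd ε hε x hx y hy
        gcongr
    refine h.trans (mul_le_mul_of_nonneg_left ?_ (by positivity))
    rw [abs_of_nonneg (by linarith [htH x])]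
    linarith [hpos x]
  · intro x hx
    refine tendsto_integral_comp_of_bounded (F := fun s : ℂ => 2 * ‖s‖ ^ 2) (C := C)
      (X := fun ε y => upDiff ε u (x, y)) (by fun_prop) ?_ ?_ ?_
    · filter_upwards [hev] with ε hε
      refine ((continuousOn_vertical (hcont ε hε) x).mono fun y hy => ?_).aestronglyMeasurable
        measurableSet_uIoc
      rw [uIoc_of_le (htH x)] at hy
      exact (lt_add_of_pos_right (f x) ht).trans hy.1
    · filter_upwards [hev] with ε hε y hy using hbd ε hε x hx y hy
    · intro y hy
      rw [uIoc_of_le (htH x)] at hy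
      have hy' : f x < y := (lt_add_of_pos_right (f x) ht).trans hy.1
      have h := hu.tendsto_avgData hH hy'.le tendsto_const_nhds (fun _ _ => le_rfl)
        fun _ _ => hy'
      exact h.snd_nhds.snd_nhds

/-- The flux of the Rellich field through the line `y = H` dominates the vertical energy. -/
theorem IsSolution.integral_vertical_energy_le (hu : IsSolution f k L ν u ux uy uxx uyy)
    (hL : 0 ≤ L) (hν : ‖ν‖ = 1) (hpos : ∀ x, 0 ≤ f x) (hf : LipschitzWith K f)
    (hper : ∀ x, f (x + L) = f x) (hH : ∀ x, f x < H) (h0 : ∀ x, u (x, f x) = 0) {t : ℝ}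
    (ht : 0 < t) (htH : ∀ x, f x + t ≤ H) :
    ∫ x in (0 : ℝ)..L, ∫ y in (f x + t)..H, 2 * ‖uy (x, y)‖ ^ 2 ≤
      ∫ x in (0 : ℝ)..L, rellichFlux k 0 H (u (x, H)) (ux (x, H)) (uy (x, H)) := by
  have hfc := hf.continuous
  have hlim := hu.tendsto_integral_stripData hL hpos hf hH
    (F := fun q => rellichFlux k 0 H q.1.1 q.1.2.1 q.1.2.2 -
      rellichFlux k q.2.1.1 q.2.1.2 q.2.2.1 q.2.2.2.1 q.2.2.2.2) (by unfold rellichFlux; fun_prop)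
  have hcl : ∀ {g : ℝ × ℝ → ℂ}, ContinuousOn g (epiClosed f) → ∀ {s : ℝ → ℝ}, Continuous s →
      (∀ x, f x ≤ s x) → Continuous fun x => g (x, s x) := fun hg _ hs hfs =>
    hg.comp_continuous (by fun_prop) hfs
  have top : Continuous fun x => rellichFlux k 0 H (u (x, H)) (ux (x, H)) (uy (x, H)) := by
    have h1 := hcl hu.cont continuous_const fun x => (hH x).le
    have h2 := hcl hu.cont_x continuous_const fun x => (hH x).le
    have h3 := hcl hu.cont_y continuous_const fun x => (hH x).le
    have hF : Continuous fun q : ℂ × ℂ × ℂ => rellichFlux k 0 H q.1 q.2.1 q.2.2 := by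
      unfold rellichFlux
      fun_prop
    exact hF.comp (h1.prodMk (h2.prodMk h3))
  have bottom : IntervalIntegrable (fun x => rellichFlux k (deriv f x) (f x) (u (x, f x))
      (ux (x, f x)) (uy (x, f x))) volume 0 L := by
    have h1 := hcl hu.cont hfc fun x => le_rfl
    have h2 := hcl hu.cont_x hfc fun x => le_rfl
    have h3 := hcl hu.cont_y hfc fun x => le_rfl
    have h4 := hfc.prodMk (h1.prodMk (h2.prodMk h3))
    obtain ⟨C, hC⟩ := (isCompact_Icc (a := 0) (b := L)).exists_bound_of_continuousOn h4.continuousOn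
    refine intervalIntegrable_comp_of_bounded
      (F := fun q : ℝ × ℝ × ℂ × ℂ × ℂ => rellichFlux k q.1 q.2.1 q.2.2.1 q.2.2.2.1 q.2.2.2.2)
      (X := fun x => (deriv f x, f x, u (x, f x), ux (x, f x), uy (x, f x)))
      (C := max K C) (by unfold rellichFlux; fun_prop)
      ((measurable_deriv f).aestronglyMeasurable.prodMk h4.aestronglyMeasurable) fun x hx => ?_
    rw [uIoc_of_le hL] at hx
    exact max_le_max (norm_deriv_le_of_lipschitz hf) (hC x (Ioc_subset_Icc_self hx))
  have step : ∫ x in (0 : ℝ)..L, ∫ y in (f x + t)..H, 2 * ‖uy (x, y)‖ ^ 2 ≤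
      ∫ x in (0 : ℝ)..L, (rellichFlux k 0 H (u (x, H)) (ux (x, H)) (uy (x, H)) -
        rellichFlux k (deriv f x) (f x) (u (x, f x)) (ux (x, f x)) (uy (x, f x))) := by
    refine le_of_tendsto_of_tendsto (hu.tendsto_integral_vertical_energy hL hpos hfc hH ht htH)
      hlim ?_
    filter_upwards [Ioo_mem_nhdsGT ht] with ε hε
    have hreg := hu.isRegularSolution_upDiff hfc hH hε.1.le
    have hlt : ∀ {s : ℝ}, 0 < s → ∀ x, f x < f x + s := fun hs x => lt_add_of_pos_right _ hs
    have h := hreg.rellich_identity hν hfc hH (lipschitzWith_add_const hf ε) (hlt hε.1)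
      (fun x => by rw [hper])
    simp only [deriv_add_const] at h
    change _ ≤ ∫ x in (0 : ℝ)..L, (rellichFlux k 0 H (upDiff ε (prim H u) (x, H))
        (upDiff ε (prim H ux) (x, H)) (upDiff ε u (x, H)) -
      rellichFlux k (deriv f x) (f x + ε) (upDiff ε (prim H u) (x, f x + ε))
        (upDiff ε (prim H ux) (x, f x + ε)) (upDiff ε u (x, f x + ε)))
    rw [h]
    have hg : ContinuousOn (fun p => 2 * ‖upDiff ε u p‖ ^ 2) (epi f) :=
      continuousOn_const.mul (hreg.cont_y.norm.pow 2)
    refine intervalIntegral.integral_mono_on hL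
      ((continuous_integral_above_graph hfc hH (by fun_prop) (hlt ht) hg).intervalIntegrable _ _)
      ((continuous_integral_above_graph hfc hH (by fun_prop) (hlt hε.1) hg).intervalIntegrable _ _)
      fun x _ => ?_
    exact intervalIntegral.integral_mono_interval (by linarith [hε.2]) (htH x) le_rfl
      (ae_of_all _ fun y => by positivity) (intervalIntegrable_vertical hg (hlt hε.1 x) (hH x))
  refine step.trans (intervalIntegral.integral_mono_ae hL
    ((top.intervalIntegrable _ _).sub bottom) (top.intervalIntegrable _ _) ?_)
  filter_upwards [hf.ae_differentiableAt_real] with x hx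
  exact sub_le_self _ (hu.rellichFlux_graph_nonneg hpos hf h0 hx)

end Limits

section Fourier

/-- The (unnormalised) Fourier coefficient of `g` on `[0, L]` at frequency `ξ`. -/
noncomputable def modeCoeff (L ξ : ℝ) (g : ℝ → ℂ) : ℂ :=
  ∫ x in (0 : ℝ)..L, Complex.exp (-(Complex.I * ξ * x)) * g x

variable {L κ ξ : ℝ} {lam : ℤ → ℝ} {g h : ℝ → ℂ}

theorem continuous_exp_mul (hg : Continuous g) (ξ : ℝ) :
    Continuous fun x : ℝ => Complex.exp (-(Complex.I * ξ * x)) * g x := by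
  fun_prop

theorem modeCoeff_add (hg : Continuous g) (hh : Continuous h) :
    modeCoeff L ξ (fun x => g x + h x) = modeCoeff L ξ g + modeCoeff L ξ h := by
  simp only [modeCoeff, mul_add]
  exact intervalIntegral.integral_add ((continuous_exp_mul hg ξ).intervalIntegrable _ _)
    ((continuous_exp_mul hh ξ).intervalIntegrable _ _)

theorem modeCoeff_const_mul (c : ℂ) : modeCoeff L ξ (fun x => c * g x) = c * modeCoeff L ξ g := by
  simp only [modeCoeff, mul_left_comm _ c]
  exact intervalIntegral.integral_const_mul _ _

theorem modeCoeff_sub (hg : Continuous g) (hh : Continuous h) :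
    modeCoeff L ξ (fun x => g x - h x) = modeCoeff L ξ g - modeCoeff L ξ h := by
  simp only [modeCoeff, mul_sub]
  exact intervalIntegral.integral_sub ((continuous_exp_mul hg ξ).intervalIntegrable _ _)
    ((continuous_exp_mul hh ξ).intervalIntegrable _ _)

theorem modeCoeff_sum {ι : Type*} (s : Finset ι) {w : ι → ℝ → ℂ} (hw : ∀ i, Continuous (w i)) :
    modeCoeff L ξ (fun x => ∑ i ∈ s, w i x) = ∑ i ∈ s, modeCoeff L ξ (w i) := by
  simp only [modeCoeff, Finset.mul_sum]
  exact intervalIntegral.integral_finsetSum fun i _ =>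
    (continuous_exp_mul (hw i) ξ).intervalIntegrable _ _

/-- Parseval's identity for quasiperiodic exponentials. -/
theorem hasSum_sq_norm_modeCoeff (hL : 0 < L) (hlam : ∀ j : ℤ, lam j = κ + 2 * Real.pi * j / L)
    (hg : Continuous g) :
    HasSum (fun j => ‖modeCoeff L (lam j) g‖ ^ 2) (L * ∫ x in (0 : ℝ)..L, ‖g x‖ ^ 2) := by
  set w : ℝ → ℂ := fun x => Complex.exp (-(Complex.I * κ * x)) * g x with hw
  have hwc : Continuous w := continuous_exp_mul hg κ
  have hmem : MemLp w 2 (volume.restrict (Ioc 0 L)) := by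
    obtain ⟨C, hC⟩ := (isCompact_Icc (a := 0) (b := L)).exists_bound_of_continuousOn
      hwc.continuousOn
    refine MemLp.of_bound hwc.aestronglyMeasurable C ?_
    filter_upwards [ae_restrict_mem measurableSet_Ioc] with x hx
    exact hC x (Ioc_subset_Icc_self hx)
  have hnorm : ∀ x, ‖w x‖ = ‖g x‖ := fun x => by
    have : -(Complex.I * κ * x) = ((-(κ * x) : ℝ) : ℂ) * Complex.I := by
      push_cast
      ring
    rw [hw]
    simp only [norm_mul, this, Complex.norm_exp_ofReal_mul_I, one_mul]
  have hcoeff : ∀ j, modeCoeff L (lam j) g = L * fourierCoeffOn hL w j := fun j => by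
    have hL' : (L : ℂ) ≠ 0 := Complex.ofReal_ne_zero.2 hL.ne'
    rw [fourierCoeffOn_eq_integral, sub_zero, Complex.real_smul, Complex.ofReal_div,
      Complex.ofReal_one, ← mul_assoc, mul_one_div_cancel hL', one_mul, modeCoeff]
    refine intervalIntegral.integral_congr fun x _ => ?_
    simp only [hw, fourier_coe_apply, smul_eq_mul, ← mul_assoc, ← Complex.exp_add, hlam]
    congr 2
    push_cast
    field_simp
    ring
  have hP := (hasSum_sq_fourierCoeffOn hL hmem).mul_left (L ^ 2)
  simp only [hnorm, sub_zero, smul_eq_mul] at hP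
  rw [← mul_assoc, sq L, mul_inv_cancel_right₀ hL.ne'] at hP
  simpa only [hcoeff, norm_mul, Complex.norm_of_nonneg hL.le, mul_pow, sq L] using hP

/-- The polarised form of Parseval's identity. -/
theorem hasSum_inner_modeCoeff (hL : 0 < L) (hlam : ∀ j : ℤ, lam j = κ + 2 * Real.pi * j / L)
    (hg : Continuous g) (hh : Continuous h) :
    HasSum (fun j => inner ℝ (modeCoeff L (lam j) g) (modeCoeff L (lam j) h))
      (L * ∫ x in (0 : ℝ)..L, inner ℝ (g x) (h x)) := by
  have hi : ∀ z w : ℂ, inner ℝ z w = (‖z + w‖ ^ 2 - ‖z‖ ^ 2 - ‖w‖ ^ 2) / 2 := fun z w => by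
    rw [real_inner_eq_norm_add_mul_self_sub_norm_mul_self_sub_norm_mul_self_div_two]
    simp only [sq]
  have h1 := ((hasSum_sq_norm_modeCoeff hL hlam (hg.add hh)).sub
    (hasSum_sq_norm_modeCoeff hL hlam hg)).sub (hasSum_sq_norm_modeCoeff hL hlam hh)
  have h2 := h1.div_const 2
  have h3 : L * ∫ x in (0 : ℝ)..L, inner ℝ (g x) (h x) =
      ((L * ∫ x in (0 : ℝ)..L, ‖(g + h) x‖ ^ 2) - (L * ∫ x in (0 : ℝ)..L, ‖g x‖ ^ 2) -
        L * ∫ x in (0 : ℝ)..L, ‖h x‖ ^ 2) / 2 := by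
    simp only [hi, Pi.add_apply]
    rw [intervalIntegral.integral_div, intervalIntegral.integral_sub, intervalIntegral.integral_sub]
    · ring
    all_goals exact Continuous.intervalIntegrable (by fun_prop) _ _
  rw [h3]
  simp only [hi, ← modeCoeff_add hg hh]
  exact h2

theorem exp_two_pi_int_eq_one (hL : L ≠ 0) (j : ℤ) :
    Complex.exp (Complex.I * (2 * Real.pi * j / L : ℝ) * L) = 1 := by
  have hL' : (L : ℂ) ≠ 0 := Complex.ofReal_ne_zero.2 hL
  rw [← Complex.exp_int_mul_two_pi_mul_I j]
  congr 1
  push_cast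
  field_simp

theorem modeCoeff_exp (hL : 0 < L) (hlam : ∀ j : ℤ, lam j = κ + 2 * Real.pi * j / L) (i j : ℤ) :
    modeCoeff L (lam j) (fun x => Complex.exp (Complex.I * lam i * x)) =
      if i = j then (L : ℂ) else 0 := by
  have hL' : (L : ℂ) ≠ 0 := Complex.ofReal_ne_zero.2 hL.ne'
  have h : ∀ x : ℝ, Complex.exp (-(Complex.I * lam j * x)) * Complex.exp (Complex.I * lam i * x) =
      Complex.exp (Complex.I * (2 * Real.pi * (i - j : ℤ) / L : ℝ) * x) := fun x => by
    rw [← Complex.exp_add, hlam, hlam]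
    congr 1
    push_cast
    ring
  simp only [modeCoeff, h]
  split_ifs with hij
  · simp [hij]
  · rw [integral_exp_mul_complex, exp_two_pi_int_eq_one hL.ne']
    · simp
    · have : ((i - j : ℤ) : ℂ) ≠ 0 := Int.cast_ne_zero.2 (sub_ne_zero.2 hij)
      have hpi : (Real.pi : ℂ) ≠ 0 := Complex.ofReal_ne_zero.2 Real.pi_ne_zero
      push_cast at this ⊢
      simp [this, hpi, hL', Complex.I_ne_zero]

/-- Convergence in mean determines the coefficients of a generalised Fourier series. -/
theorem modeCoeff_eq_of_tendsto (hL : 0 < L) (hlam : ∀ j : ℤ, lam j = κ + 2 * Real.pi * j / L)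
    (hg : Continuous g) {φ : ℤ → ℝ → ℂ}
    (hφ : ∀ (j : ℤ) (x : ℝ), φ j x = Complex.exp (Complex.I * lam j * x) / Real.sqrt L) {b : ℤ → ℂ}
    (hlim : Tendsto (fun s : Finset ℤ => ∫ x in (0 : ℝ)..L, ‖g x - ∑ j ∈ s, b j * φ j x‖ ^ 2)
      atTop (𝓝 0)) (j : ℤ) :
    modeCoeff L (lam j) g = Real.sqrt L * b j := by
  have hφc : ∀ i, Continuous fun x => b i * φ i x := fun i => by
    simp only [hφ]
    fun_prop
  have hsq : (L : ℂ) / Real.sqrt L = Real.sqrt L := by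
    rw [← Complex.ofReal_div, Real.div_sqrt]
  have hterm : ∀ i, modeCoeff L (lam j) (fun x => b i * φ i x) =
      if i = j then Real.sqrt L * b j else 0 := fun i => by
    have : ∀ x, b i * φ i x = b i / Real.sqrt L * Complex.exp (Complex.I * lam i * x) := fun x => by
      rw [hφ]
      ring
    simp only [this]
    rw [modeCoeff_const_mul, modeCoeff_exp hL hlam]
    split_ifs with hij
    · rw [hij]
      nth_rw 2 [← hsq]
      ring
    · ring
  have hle : ∀ᶠ s : Finset ℤ in atTop, ‖modeCoeff L (lam j) g - Real.sqrt L * b j‖ ^ 2 ≤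
      L * ∫ x in (0 : ℝ)..L, ‖g x - ∑ j ∈ s, b j * φ j x‖ ^ 2 := by
    filter_upwards [eventually_ge_atTop {j}] with s hs
    have hjs : j ∈ s := hs (Finset.mem_singleton_self j)
    have hsum : Continuous fun x => ∑ i ∈ s, b i * φ i x := continuous_finsetSum _ fun i _ => hφc i
    have h := le_hasSum (hasSum_sq_norm_modeCoeff hL hlam (hg.sub hsum)) j
      fun i _ => by positivity
    have e := modeCoeff_sub (L := L) (ξ := lam j) hg hsum
    rw [modeCoeff_sum s hφc] at e
    simp only [hterm, Finset.sum_ite_eq', hjs, if_true] at e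
    rw [← e]
    exact h
  have h0 := ge_of_tendsto (hlim.const_mul L) hle
  rw [mul_zero] at h0
  have : ‖modeCoeff L (lam j) g - Real.sqrt L * b j‖ = 0 := by
    have := norm_nonneg (modeCoeff L (lam j) g - Real.sqrt L * b j)
    nlinarith
  exact sub_eq_zero.1 (norm_eq_zero.1 this)

theorem modeCoeff_deriv (hL : L ≠ 0) (hlam : ∀ j : ℤ, lam j = κ + 2 * Real.pi * j / L)
    {g' : ℝ → ℂ} (hg' : Continuous g') (hd : ∀ x, HasDerivAt g (g' x) x)
    (hq : g L = Complex.exp (Complex.I * κ * L) * g 0) (j : ℤ) :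
    modeCoeff L (lam j) g' = Complex.I * lam j * modeCoeff L (lam j) g := by
  have hg : Continuous g := continuous_iff_continuousAt.2 fun x => (hd x).continuousAt
  have hE : ∀ x : ℝ, HasDerivAt (fun x : ℝ => Complex.exp (-(Complex.I * lam j * x)))
      (-(Complex.I * lam j) * Complex.exp (-(Complex.I * lam j * x))) x := fun x => by
    have h1 : HasDerivAt (fun x : ℝ => -(Complex.I * lam j * x)) (-(Complex.I * lam j)) x := by
      have h2 := ((Complex.ofRealCLM.hasDerivAt (x := x)).const_mul (Complex.I * lam j)).neg
      rw [Complex.ofRealCLM_apply, Complex.ofReal_one, mul_one] at h2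
      exact h2
    exact h1.cexp.congr_deriv (mul_comm _ _)
  have hper : Complex.exp (-(Complex.I * lam j * L)) * Complex.exp (Complex.I * κ * L) = 1 := by
    have h1 := exp_two_pi_int_eq_one hL (-j)
    rw [← h1, ← Complex.exp_add, hlam]
    congr 1
    push_cast
    ring
  have h := intervalIntegral.integral_mul_deriv_eq_deriv_mul (a := 0) (b := L)
    (fun x _ => hE x) (fun x _ => hd x)
    (Continuous.intervalIntegrable (by fun_prop) _ _) (hg'.intervalIntegrable _ _)
  rw [modeCoeff, h, hq, ← mul_assoc, hper]
  simp only [Complex.ofReal_zero, mul_zero, neg_zero, Complex.exp_zero, sub_self, zero_sub,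
    mul_assoc, neg_mul, intervalIntegral.integral_neg, neg_neg,
    intervalIntegral.integral_const_mul, modeCoeff]

theorem hasDerivAt_modeCoeff {w wy : ℝ × ℝ → ℂ} {M H : ℝ} (hH : M < H) (hL : 0 ≤ L)
    (hw : ContinuousOn w {p | M < p.2}) (hwy : ContinuousOn wy {p | M < p.2})
    (hd : ∀ p : ℝ × ℝ, M < p.2 → HasDerivAt (fun t => w (p.1, t)) (wy p) p.2) (ξ : ℝ) :
    HasDerivAt (fun y => modeCoeff L ξ fun x => w (x, y)) (modeCoeff L ξ fun x => wy (x, H)) H := by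
  set δ := (H - M) / 2 with hδ
  have hδ0 : 0 < δ := by linarith
  have hcont : ∀ {g : ℝ × ℝ → ℂ}, ContinuousOn g {p | M < p.2} → ∀ y, M < y →
      Continuous fun x => g (x, y) := fun hg y hy => hg.comp_continuous (by fun_prop) fun _ => hy
  have hK : IsCompact (Icc 0 L ×ˢ Icc (H - δ) (H + δ)) := isCompact_Icc.prod isCompact_Icc
  have hsub : Icc 0 L ×ˢ Icc (H - δ) (H + δ) ⊆ {p : ℝ × ℝ | M < p.2} := fun p hp => by
    have := hp.2.1
    change M < p.2
    linarith
  obtain ⟨C, hC⟩ := hK.exists_bound_of_continuousOn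
    (f := fun p : ℝ × ℝ => Complex.exp (-(Complex.I * ξ * p.1)) * wy p)
    (by
      have := hwy.mono hsub
      fun_prop)
  refine (intervalIntegral.hasDerivAt_integral_of_dominated_loc_of_deriv_le
    (F := fun y x => Complex.exp (-(Complex.I * ξ * x)) * w (x, y))
    (F' := fun y x => Complex.exp (-(Complex.I * ξ * x)) * wy (x, y)) (bound := fun _ => C)
    (s := Ioo (H - δ) (H + δ)) (Ioo_mem_nhds (by linarith) (by linarith)) ?_ ?_ ?_ ?_
    intervalIntegrable_const ?_).2
  · filter_upwards [Ioi_mem_nhds hH] with y hy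
    exact (continuous_exp_mul (hcont hw y hy) ξ).aestronglyMeasurable
  · exact (continuous_exp_mul (hcont hw H hH) ξ).intervalIntegrable _ _
  · exact (continuous_exp_mul (hcont hwy H hH) ξ).aestronglyMeasurable
  · refine ae_of_all _ fun x hx y hy => ?_
    rw [uIoc_of_le hL] at hx
    exact hC (x, y) ⟨Ioc_subset_Icc_self hx, Ioo_subset_Icc_self hy⟩
  · refine ae_of_all _ fun x _ y hy => (hd (x, y) ?_).const_mul _
    have := hy.1
    change M < y
    linarith

end Fourier

section Uniqueness

variable {f : ℝ → ℝ} {k κ H L M : ℝ} {K : NNReal} {ν : ℂ} {u ux uy uxx uyy : ℝ × ℝ → ℂ}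
  {lam : ℤ → ℝ} {μ : ℤ → ℂ} {v vx vy : ℝ → ℂ}

theorem inner_self_mul (z w : ℂ) : inner ℝ w (z * w) = z.re * ‖w‖ ^ 2 := by
  rw [Complex.inner, Complex.sq_norm, Complex.normSq_apply]
  simp only [Complex.mul_re, Complex.conj_re, Complex.conj_im, Complex.mul_im]
  ring

theorem hasSum_energyFlux (hL : 0 < L) (hlam : ∀ j : ℤ, lam j = κ + 2 * Real.pi * j / L)
    (hv : Continuous v) (hvy : Continuous vy)
    (hy : ∀ j, modeCoeff L (lam j) vy = Complex.I * μ j * modeCoeff L (lam j) v) :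
    HasSum (fun j => (μ j).re * ‖modeCoeff L (lam j) v‖ ^ 2)
      (L * ∫ x in (0 : ℝ)..L, energyFlux 0 (v x) (vx x) (vy x)) := by
  have h := hasSum_inner_modeCoeff hL hlam hv (hvy.const_mul (-Complex.I))
  simp only [modeCoeff_const_mul, hy] at h
  have e1 : ∀ j, -Complex.I * (Complex.I * μ j * modeCoeff L (lam j) v) =
      μ j * modeCoeff L (lam j) v := fun j => by
    linear_combination -(μ j * modeCoeff L (lam j) v) * Complex.I_mul_I
  have e2 : ∀ x, inner ℝ (v x) (-Complex.I * vy x) = energyFlux 0 (v x) (vx x) (vy x) := fun x => by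
    simp [Complex.inner, energyFlux]
    ring
  simpa only [e1, e2, inner_self_mul] using h

theorem hasSum_rellichFlux (hL : 0 < L) (hlam : ∀ j : ℤ, lam j = κ + 2 * Real.pi * j / L)
    (hv : Continuous v) (hvx : Continuous vx) (hvy : Continuous vy)
    (hx : ∀ j, modeCoeff L (lam j) vx = Complex.I * lam j * modeCoeff L (lam j) v)
    (hy : ∀ j, modeCoeff L (lam j) vy = Complex.I * μ j * modeCoeff L (lam j) v) (k H : ℝ) :
    HasSum (fun j => (H * (‖μ j‖ ^ 2 - lam j ^ 2 + k ^ 2) - (μ j).im) *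
        ‖modeCoeff L (lam j) v‖ ^ 2)
      (L * ∫ x in (0 : ℝ)..L, rellichFlux k 0 H (v x) (vx x) (vy x)) := by
  have hyy := hasSum_inner_modeCoeff hL hlam hvy hvy
  have hxx := hasSum_inner_modeCoeff hL hlam hvx hvx
  have h00 := hasSum_inner_modeCoeff hL hlam hv hv
  have h0y := hasSum_inner_modeCoeff hL hlam hv hvy
  have h := (((hyy.sub hxx).add (h00.mul_left (k ^ 2))).mul_left H).add h0y
  simp only [hx, hy, inner_self_mul, norm_mul, mul_pow, Complex.norm_I, one_mul,
    real_inner_self_eq_norm_sq, Complex.norm_real, Complex.I_mul_re, Real.norm_eq_abs, sq_abs] at h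
  have e : ∀ x, rellichFlux k 0 H (v x) (vx x) (vy x) =
      H * (‖vy x‖ ^ 2 - ‖vx x‖ ^ 2 + k ^ 2 * ‖v x‖ ^ 2) + inner ℝ (v x) (vy x) := fun x => by
    simp only [rellichFlux, Complex.inner, Complex.sq_norm, Complex.normSq_apply, Complex.mul_re,
      Complex.conj_re, Complex.conj_im]
    ring
  have hint : L * ∫ x in (0 : ℝ)..L, rellichFlux k 0 H (v x) (vx x) (vy x) =
      H * ((L * ∫ x in (0 : ℝ)..L, ‖vy x‖ ^ 2) - (L * ∫ x in (0 : ℝ)..L, ‖vx x‖ ^ 2) +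
        k ^ 2 * (L * ∫ x in (0 : ℝ)..L, ‖v x‖ ^ 2)) +
      L * ∫ x in (0 : ℝ)..L, inner ℝ (v x) (vy x) := by
    simp only [e]
    rw [intervalIntegral.integral_add, intervalIntegral.integral_const_mul,
      intervalIntegral.integral_add, intervalIntegral.integral_sub,
      intervalIntegral.integral_const_mul]
    · ring
    all_goals exact Continuous.intervalIntegrable (by fun_prop) _ _
  rw [hint]
  refine h.congr_fun fun j => ?_
  ring

/-- A sum of outgoing modes carrying no energy has nonpositive Rellich flux. -/
theorem integral_rellichFlux_nonpos (hL : 0 < L)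
    (hlam : ∀ j : ℤ, lam j = κ + 2 * Real.pi * j / L) (hnr : ∀ j, lam j ^ 2 ≠ k ^ 2)
    (hμ1 : ∀ j : ℤ, lam j ^ 2 < k ^ 2 → μ j = (Real.sqrt (k ^ 2 - lam j ^ 2) : ℝ))
    (hμ2 : ∀ j : ℤ, k ^ 2 < lam j ^ 2 → μ j = Complex.I * (Real.sqrt (lam j ^ 2 - k ^ 2) : ℝ))
    (hv : Continuous v) (hvx : Continuous vx) (hvy : Continuous vy)
    (hx : ∀ j, modeCoeff L (lam j) vx = Complex.I * lam j * modeCoeff L (lam j) v)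
    (hy : ∀ j, modeCoeff L (lam j) vy = Complex.I * μ j * modeCoeff L (lam j) v)
    (henergy : ∫ x in (0 : ℝ)..L, energyFlux 0 (v x) (vx x) (vy x) = 0) (H : ℝ) :
    ∫ x in (0 : ℝ)..L, rellichFlux k 0 H (v x) (vx x) (vy x) ≤ 0 := by
  have hE := hasSum_energyFlux hL hlam hv hvy hy (vx := vx)
  rw [henergy, mul_zero] at hE
  have hre : ∀ j, 0 ≤ (μ j).re := fun j => by
    rcases lt_or_gt_of_ne (hnr j) with h | h
    · rw [hμ1 j h, Complex.ofReal_re]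
      exact Real.sqrt_nonneg _
    · simp [hμ2 j h]
  have hzero := (hasSum_zero_iff_of_nonneg fun j => mul_nonneg (hre j) (sq_nonneg _)).1 hE
  have hR := hasSum_rellichFlux hL hlam hv hvx hvy hx hy k H
  have hle := hR.nonpos fun j => ?_
  · exact nonpos_of_mul_nonpos_right hle hL
  · rcases lt_or_gt_of_ne (hnr j) with h | h
    · have h1 : (μ j).re ≠ 0 := by
        rw [hμ1 j h, Complex.ofReal_re]
        exact (Real.sqrt_pos.2 (sub_pos.2 h)).ne'
      rw [(mul_eq_zero.1 (congrFun hzero j)).resolve_left h1, mul_zero]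
    · have h1 : ‖μ j‖ ^ 2 = lam j ^ 2 - k ^ 2 := by
        rw [hμ2 j h, norm_mul, Complex.norm_I, one_mul, Complex.norm_real, Real.norm_eq_abs,
          sq_abs, Real.sq_sqrt (sub_pos.2 h).le]
      have h2 : 0 ≤ (μ j).im := by
        simp [hμ2 j h]
      rw [h1]
      have := mul_nonneg h2 (sq_nonneg ‖modeCoeff L (lam j) v‖)
      linarith

theorem eqOn_zero_of_integral_nonpos {g : ℝ → ℝ} {a b : ℝ} (hab : a < b)
    (hg : ContinuousOn g (Icc a b)) (h0 : ∀ x ∈ Icc a b, 0 ≤ g x) (hle : ∫ x in a..b, g x ≤ 0)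
    {x : ℝ} (hx : x ∈ Icc a b) : g x = 0 := by
  by_contra hne
  exact hle.not_gt (intervalIntegral.integral_pos hab hg
    (fun y hy => h0 y (Ioc_subset_Icc_self hy)) ⟨x, hx, (h0 x hx).lt_of_ne' hne⟩)

theorem IsSolution.eq_zero_of_integral_rellichFlux_nonpos
    (hu : IsSolution f k L ν u ux uy uxx uyy) (hL : 0 < L) (hν : ‖ν‖ = 1) (hpos : ∀ x, 0 ≤ f x)
    (hf : LipschitzWith K f) (hper : ∀ x, f (x + L) = f x) (hM : ∀ x, f x ≤ M)
    (h0 : ∀ x, u (x, f x) = 0)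
    (hflux : ∀ H, M < H →
      ∫ x in (0 : ℝ)..L, rellichFlux k 0 H (u (x, H)) (ux (x, H)) (uy (x, H)) ≤ 0)
    {p : ℝ × ℝ} (hp : p ∈ epi f) : u p = 0 := by
  have hfc := hf.continuous
  have hcy : ContinuousOn (fun q => 2 * ‖uy q‖ ^ 2) (epi f) :=
    continuousOn_const.mul ((hu.cont_y.mono (epi_subset_epiClosed f)).norm.pow 2)
  have huy : ∀ x ∈ Icc 0 L, ∀ y, f x < y → uy (x, y) = 0 := fun x hx y hy => by
    set t := min 1 (y - f x) with ht
    have ht0 : 0 < t := lt_min one_pos (sub_pos.2 hy)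
    have ht1 : t ≤ 1 := min_le_left _ _
    set H := max M y + 2 with hH
    have hMH : M + 2 ≤ H := by linarith [le_max_left M y]
    have hfH : ∀ x, f x + t < H := fun x => by linarith [hM x]
    have hlt : ∀ x, f x < f x + t := fun x => lt_add_of_pos_right _ ht0
    have hfH' : ∀ x, f x < H := fun x => (hlt x).trans (hfH x)
    have h1 := (hu.integral_vertical_energy_le hL.le hν hpos hf hper hfH' h0 ht0
      fun x => (hfH x).le).trans (hflux H (by linarith))
    have h2 := eqOn_zero_of_integral_nonpos hL
      (continuous_integral_above_graph hfc hfH' (by fun_prop) hlt hcy).continuousOn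
      (fun x _ => intervalIntegral.integral_nonneg (hfH x).le fun y _ => by positivity) h1 hx
    have h3 := eqOn_zero_of_integral_nonpos (hfH x)
      ((continuousOn_vertical hcy x).mono fun r hr => (hlt x).trans_le hr.1)
      (fun y _ => by positivity) h2.le (x := y)
      ⟨by linarith [min_le_right 1 (y - f x)], by linarith [le_max_right M y]⟩
    simpa using h3
  have hzero : ∀ x ∈ Icc 0 L, ∀ y, f x < y → u (x, y) = 0 := fun x hx y hy => by
    have hsub : uIcc (f x) y ⊆ Ici (f x) := fun r hr => by
      rw [uIcc_of_le hy.le] at hr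
      exact hr.1
    have h1 := intervalIntegral.integral_eq_sub_of_hasDerivAt (f := fun r => u (x, r))
      (f' := fun r => uy (x, r)) (fun r hr => hu.deriv_y (x, r) (hsub hr))
      ((hu.cont_y.comp (f := fun r => (x, r)) (by fun_prop) hsub).intervalIntegrable)
    rw [h0, sub_zero] at h1
    rw [← h1]
    refine intervalIntegral.integral_zero_ae (ae_of_all _ fun r hr => huy x hx r ?_)
    rw [uIoc_of_le hy.le] at hr
    exact hr.1
  have hν0 : ν ≠ 0 := norm_ne_zero_iff.1 (hν ▸ one_ne_zero)
  have hperiodic : Function.Periodic (fun x => ∀ y, f x < y → u (x, y) = 0) L := fun x => by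
    refine propext (forall_congr' fun y => ?_)
    rw [hper]
    refine forall_congr' fun hy => ?_
    rw [hu.quasi (x, y) (le_of_lt hy), mul_eq_zero, or_iff_right hν0]
  obtain ⟨x, hx, he⟩ := hperiodic.exists_mem_Ico₀ hL p.1
  have h := he.mpr (hzero x (Ico_subset_Icc_self hx))
  exact h p.2 hp

/-- A quasiperiodic solution with vanishing boundary values which is a superposition of outgoing
modes vanishes identically. -/
theorem IsSolution.eq_zero_of_outgoing (hu : IsSolution f k L ν u ux uy uxx uyy) (hL : 0 < L)
    (hν : ν = Complex.exp (Complex.I * κ * L)) (hpos : ∀ x, 0 ≤ f x)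
    (hf : LipschitzWith K f) (hper : ∀ x, f (x + L) = f x) (hM : ∀ x, f x ≤ M)
    (h0 : ∀ x, u (x, f x) = 0)
    (hlam : ∀ j : ℤ, lam j = κ + 2 * Real.pi * j / L) (hnr : ∀ j, lam j ^ 2 ≠ k ^ 2)
    (hμ1 : ∀ j : ℤ, lam j ^ 2 < k ^ 2 → μ j = (Real.sqrt (k ^ 2 - lam j ^ 2) : ℝ))
    (hμ2 : ∀ j : ℤ, k ^ 2 < lam j ^ 2 → μ j = Complex.I * (Real.sqrt (lam j ^ 2 - k ^ 2) : ℝ))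
    {a : ℤ → ℂ} (hmode : ∀ y, M < y → ∀ j, modeCoeff L (lam j) (fun x => u (x, y)) =
      a j * Complex.exp (Complex.I * μ j * y)) {p : ℝ × ℝ} (hp : p ∈ epi f) : u p = 0 := by
  have hν1 : ‖ν‖ = 1 := by
    have : Complex.I * κ * L = ((κ * L : ℝ) : ℂ) * Complex.I := by
      push_cast
      ring
    rw [hν, this, Complex.norm_exp_ofReal_mul_I]
  refine hu.eq_zero_of_integral_rellichFlux_nonpos hL hν1 hpos hf hper hM h0 (fun H hH => ?_) hp
  have hfH : ∀ {y}, M < y → ∀ x, f x < y := fun hy x => (hM x).trans_lt hy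
  have hsub : {p : ℝ × ℝ | M < p.2} ⊆ epiClosed f := fun p hp => (hfH hp p.1).le
  have hcl : ∀ {g : ℝ × ℝ → ℂ}, ContinuousOn g (epiClosed f) → Continuous fun x => g (x, H) :=
    fun hg => hg.comp_continuous (by fun_prop) fun x => (hfH hH x).le
  have hy : ∀ j, modeCoeff L (lam j) (fun x => uy (x, H)) =
      Complex.I * μ j * modeCoeff L (lam j) (fun x => u (x, H)) := fun j => by
    have h1 := hasDerivAt_modeCoeff hH hL.le (hu.cont.mono hsub) (hu.cont_y.mono hsub)
      (fun p hp => hu.deriv_y p (hsub hp)) (lam j)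
    have h2 : HasDerivAt (fun y : ℝ => Complex.I * μ j * (y : ℂ)) (Complex.I * μ j) H := by
      simpa using (Complex.ofRealCLM.hasDerivAt (x := H)).const_mul (Complex.I * μ j)
    have h3 := (h2.cexp.const_mul (a j)).congr_of_eventuallyEq
      (f₁ := fun y => modeCoeff L (lam j) fun x => u (x, y)) (by
        filter_upwards [Ioi_mem_nhds hH] with y hy using hmode y hy j)
    rw [h1.unique h3, hmode H hH]
    ring
  have hx : ∀ j, modeCoeff L (lam j) (fun x => ux (x, H)) =
      Complex.I * lam j * modeCoeff L (lam j) (fun x => u (x, H)) :=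
    modeCoeff_deriv hL.ne' hlam (hcl hu.cont_x) (fun x => hu.deriv_x (x, H) (hfH hH x).le) (by
      have := hu.quasi (0, H) (hfH hH 0).le
      rwa [zero_add, hν] at this)
  exact integral_rellichFlux_nonpos hL hlam hnr hμ1 hμ2 (hcl hu.cont) (hcl hu.cont_x)
    (hcl hu.cont_y) hx hy
    (hu.integral_energyFlux_eq_zero hL.le hν1 hpos hf hper (hfH hH) h0) H

theorem IsSolution.sub {v vx vy vxx vyy : ℝ × ℝ → ℂ} (hu : IsSolution f k L ν u ux uy uxx uyy)
    (hv : IsSolution f k L ν v vx vy vxx vyy) :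
    IsSolution f k L ν (u - v) (ux - vx) (uy - vy) (uxx - vxx) (uyy - vyy) where
  cont := hu.cont.sub hv.cont
  cont_x := hu.cont_x.sub hv.cont_x
  cont_y := hu.cont_y.sub hv.cont_y
  cont_xx := hu.cont_xx.sub hv.cont_xx
  cont_yy := hu.cont_yy.sub hv.cont_yy
  deriv_x p hp := (hu.deriv_x p hp).sub (hv.deriv_x p hp)
  deriv_y p hp := (hu.deriv_y p hp).sub (hv.deriv_y p hp)
  deriv_xx p hp := (hu.deriv_xx p hp).sub (hv.deriv_xx p hp)
  deriv_yy p hp := (hu.deriv_yy p hp).sub (hv.deriv_yy p hp)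
  helmholtz p hp := by
    simp only [Pi.sub_apply]
    linear_combination hu.helmholtz p hp - hv.helmholtz p hp
  quasi p hp := by
    simp only [Pi.sub_apply, hu.quasi p hp, hv.quasi p hp, mul_sub]
  quasi_x p hp := by
    simp only [Pi.sub_apply, hu.quasi_x p hp, hv.quasi_x p hp, mul_sub]

end Uniqueness

end PeriodicScattering

/- STATEMENT 12 (Uniqueness for the periodic scattering problem):
Context: L > 0, k > 0, θ ∈ (0,π/2), ν = e^{ikL cos θ}, λ_j = k cos θ + 2πj/L,
φ_j(x) = e^{iλ_j x}/√L, λ_j² ≠ k² for all j, μ_j = √(k²−λ_j²) for λ_j² < k² and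
μ_j = i√(λ_j²−k²) otherwise; f Lipschitz, L-periodic, nonnegative,
M = sup_{0≤x≤L} f(x); D = {y > f(x)}, closure Dbar = {y ≥ f(x)}.
u₀(x,y) = e^{ik(x cos θ − y sin θ)}.  A quasiperiodic solution w of the Helmholtz
equation is outgoing if there are constants c_j with, for every y > M,
w(x,y) = Σ_j c_j e^{iμ_j y} φ_j(x), the series converging in L²(0,L) (formalized: the
net of finite partial sums converges to w(·,y) in the L²(0,L) norm).
If u₁, u₂ are continuous on Dbar, C¹ up to the boundary, C² in D, solve Δu + k²u = 0
in D, vanish on S, are quasiperiodic, and u_i − u₀ is outgoing, then u₁ = u₂ in D. -/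
theorem statement12
    (L k θ : ℝ) (hL : 0 < L) (hk : 0 < k) (hθ : θ ∈ Set.Ioo 0 (Real.pi / 2))
    (ν : ℂ) (hν : ν = Complex.exp (Complex.I * k * L * Real.cos θ))
    (lam : ℤ → ℝ) (hlam : ∀ j : ℤ, lam j = k * Real.cos θ + 2 * Real.pi * j / L)
    (hnr : ∀ j : ℤ, (lam j) ^ 2 ≠ k ^ 2)
    (φ : ℤ → ℝ → ℂ)
    (hφ : ∀ (j : ℤ) (x : ℝ), φ j x = Complex.exp (Complex.I * lam j * x) / Real.sqrt L)
    (μ : ℤ → ℂ)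
    (hμ1 : ∀ j : ℤ, (lam j) ^ 2 < k ^ 2 → μ j = (Real.sqrt (k ^ 2 - (lam j) ^ 2) : ℝ))
    (hμ2 : ∀ j : ℤ, k ^ 2 < (lam j) ^ 2 → μ j = Complex.I * (Real.sqrt ((lam j) ^ 2 - k ^ 2) : ℝ))
    (f : ℝ → ℝ) (hlip : ∃ K : NNReal, LipschitzWith K f)
    (hper : ∀ x : ℝ, f (x + L) = f x) (hpos : ∀ x : ℝ, 0 ≤ f x)
    (M : ℝ) (hM : M = sSup (f '' Set.Icc 0 L))
    (D Dbar : Set (ℝ × ℝ))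
    (hD : D = {p : ℝ × ℝ | f p.1 < p.2})
    (hDbar : Dbar = {p : ℝ × ℝ | f p.1 ≤ p.2})
    (u₀ : ℝ × ℝ → ℂ)
    (hu₀ : ∀ p : ℝ × ℝ, u₀ p =
      Complex.exp (Complex.I * k * (p.1 * Real.cos θ - p.2 * Real.sin θ)))
    -- the first solution u₁ and its derivative data
    (u₁ u₁x u₁y u₁xx u₁yy : ℝ × ℝ → ℂ)
    (hcu₁ : ContinuousOn u₁ Dbar)
    (hcu₁x : ContinuousOn u₁x Dbar) (hcu₁y : ContinuousOn u₁y Dbar)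
    (hd1u₁ : ∀ p ∈ Dbar, HasDerivAt (fun t => u₁ (t, p.2)) (u₁x p) p.1)
    (hd2u₁ : ∀ p ∈ Dbar, HasDerivAt (fun t => u₁ (p.1, t)) (u₁y p) p.2)
    (hd11u₁ : ∀ p ∈ D, HasDerivAt (fun t => u₁x (t, p.2)) (u₁xx p) p.1)
    (hd22u₁ : ∀ p ∈ D, HasDerivAt (fun t => u₁y (p.1, t)) (u₁yy p) p.2)
    (hcu₁xx : ContinuousOn u₁xx D) (hcu₁yy : ContinuousOn u₁yy D)
    (helm₁ : ∀ p ∈ D, u₁xx p + u₁yy p + (k : ℂ) ^ 2 * u₁ p = 0)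
    (hdir₁ : ∀ x : ℝ, u₁ (x, f x) = 0)
    (hqp₁ : ∀ p ∈ Dbar, u₁ (p.1 + L, p.2) = ν * u₁ p)
    (hqp₁x : ∀ p ∈ Dbar, u₁x (p.1 + L, p.2) = ν * u₁x p)
    (c₁ : ℤ → ℂ)
    (hout₁ : ∀ y : ℝ, M < y → Filter.Tendsto
      (fun s : Finset ℤ => ∫ x in (0 : ℝ)..L,
        ‖(u₁ (x, y) - u₀ (x, y)) - ∑ j ∈ s, c₁ j * Complex.exp (Complex.I * μ j * y) * φ j x‖ ^ 2)
      Filter.atTop (nhds 0))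
    -- the second solution u₂ and its derivative data
    (u₂ u₂x u₂y u₂xx u₂yy : ℝ × ℝ → ℂ)
    (hcu₂ : ContinuousOn u₂ Dbar)
    (hcu₂x : ContinuousOn u₂x Dbar) (hcu₂y : ContinuousOn u₂y Dbar)
    (hd1u₂ : ∀ p ∈ Dbar, HasDerivAt (fun t => u₂ (t, p.2)) (u₂x p) p.1)
    (hd2u₂ : ∀ p ∈ Dbar, HasDerivAt (fun t => u₂ (p.1, t)) (u₂y p) p.2)
    (hd11u₂ : ∀ p ∈ D, HasDerivAt (fun t => u₂x (t, p.2)) (u₂xx p) p.1)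
    (hd22u₂ : ∀ p ∈ D, HasDerivAt (fun t => u₂y (p.1, t)) (u₂yy p) p.2)
    (hcu₂xx : ContinuousOn u₂xx D) (hcu₂yy : ContinuousOn u₂yy D)
    (helm₂ : ∀ p ∈ D, u₂xx p + u₂yy p + (k : ℂ) ^ 2 * u₂ p = 0)
    (hdir₂ : ∀ x : ℝ, u₂ (x, f x) = 0)
    (hqp₂ : ∀ p ∈ Dbar, u₂ (p.1 + L, p.2) = ν * u₂ p)
    (hqp₂x : ∀ p ∈ Dbar, u₂x (p.1 + L, p.2) = ν * u₂x p)
    (c₂ : ℤ → ℂ)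
    (hout₂ : ∀ y : ℝ, M < y → Filter.Tendsto
      (fun s : Finset ℤ => ∫ x in (0 : ℝ)..L,
        ‖(u₂ (x, y) - u₀ (x, y)) - ∑ j ∈ s, c₂ j * Complex.exp (Complex.I * μ j * y) * φ j x‖ ^ 2)
      Filter.atTop (nhds 0)) :
    ∀ p ∈ D, u₁ p = u₂ p := by
  obtain ⟨K, hf⟩ := hlip
  subst hD hDbar
  have hs₁ : PeriodicScattering.IsSolution f k L ν u₁ u₁x u₁y u₁xx u₁yy :=
    ⟨hcu₁, hcu₁x, hcu₁y, hcu₁xx, hcu₁yy, hd1u₁, hd2u₁, hd11u₁, hd22u₁, helm₁, hqp₁, hqp₁x⟩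
  have hs₂ : PeriodicScattering.IsSolution f k L ν u₂ u₂x u₂y u₂xx u₂yy :=
    ⟨hcu₂, hcu₂x, hcu₂y, hcu₂xx, hcu₂yy, hd1u₂, hd2u₂, hd11u₂, hd22u₂, helm₂, hqp₂, hqp₂x⟩
  have hlam' : ∀ j : ℤ, lam j = (k * Real.cos θ) + 2 * Real.pi * j / L := hlam
  have hν' : ν = Complex.exp (Complex.I * (k * Real.cos θ : ℝ) * L) := by
    rw [hν, Complex.ofReal_mul]
    congr 1
    ring
  have hfM : ∀ x, f x ≤ M := fun x => by
    have hbdd := (isCompact_Icc (a := 0) (b := L)).bddAbove_image hf.continuous.continuousOn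
    obtain ⟨y, hy, hxy⟩ := Function.Periodic.exists_mem_Ico₀ hper hL x
    rw [hM, hxy]
    exact le_csSup hbdd ⟨y, Set.Ico_subset_Icc_self hy, rfl⟩
  have hu₀c : ∀ y, Continuous fun x => u₀ (x, y) := fun y => by
    simp only [hu₀]
    fun_prop
  have hmode : ∀ {u : ℝ × ℝ → ℂ} {c : ℤ → ℂ}, ContinuousOn u {p : ℝ × ℝ | f p.1 ≤ p.2} →
      (∀ y : ℝ, M < y → Filter.Tendsto
        (fun s : Finset ℤ => ∫ x in (0 : ℝ)..L,
          ‖(u (x, y) - u₀ (x, y)) - ∑ j ∈ s, c j * Complex.exp (Complex.I * μ j * y) * φ j x‖ ^ 2)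
        Filter.atTop (nhds 0)) → ∀ y, M < y → (Continuous fun x => u (x, y)) ∧
      ∀ j, PeriodicScattering.modeCoeff L (lam j) (fun x => u (x, y)) =
        PeriodicScattering.modeCoeff L (lam j) (fun x => u₀ (x, y)) +
        Real.sqrt L * (c j * Complex.exp (Complex.I * μ j * y)) := fun hu hout y hy => by
    have hc := hu.comp_continuous (f := fun x => (x, y)) (by fun_prop)
      fun x => ((hfM x).trans_lt hy).le
    refine ⟨hc, fun j => ?_⟩
    rw [← PeriodicScattering.modeCoeff_eq_of_tendsto hL hlam' (hc.sub (hu₀c y)) hφ (hout y hy) j,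
      ← sub_eq_iff_eq_add']
    exact (PeriodicScattering.modeCoeff_sub hc (hu₀c y)).symm
  intro p hp
  refine sub_eq_zero.1 ((hs₁.sub hs₂).eq_zero_of_outgoing hL hν' hpos hf hper hfM
    (fun x => by rw [Pi.sub_apply, hdir₁, hdir₂, sub_zero]) hlam' hnr hμ1 hμ2
    (a := fun j => Real.sqrt L * (c₁ j - c₂ j)) (fun y hy j => ?_) hp)
  obtain ⟨hc₁, h₁⟩ := hmode hcu₁ hout₁ y hy
  obtain ⟨hc₂, h₂⟩ := hmode hcu₂ hout₂ y hy
  refine (PeriodicScattering.modeCoeff_sub hc₁ hc₂).trans ?_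
  rw [h₁, h₂]
  ring
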